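/- Let α>1 and 0<β<∞, let u be holomorphic on 𝔻 and φ a holomorphic self-map of 𝔻, and suppose uC_φ maps B^α boundedly into Z_β. Then there exist constants c, C > 0 depending only on α and β (not on u and φ) such that c·M ≤ ‖uC_φ‖_e ≤ C·M, where ‖uC_φ‖_e is the essential norm of uC_φ : B^α → Z_β and M = max{ limsup_{n→∞} (n+1)^α ‖(2u'φ' + uφ'')·φ^n‖_{ν_β}, limsup_{n→∞} (n+1)^{α+1} ‖u·(φ')²·φ^n‖_{ν_β}, limsup_{n→∞} (n+1)^{α-1} ‖u''·φ^n‖_{ν_β} }. -/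

import Mathlib

open Complex Filter Set

noncomputable section

/-- The open unit disk in `ℂ`. -/
def unitDisk : Set ℂ := Metric.ball 0 1

/-- The weighted sup-norm `‖g‖_{ν_γ} = sup_{z ∈ 𝔻} (1-|z|²)^γ |g(z)|`. -/
def wnorm (γ : ℝ) (g : ℂ → ℂ) : ℝ :=
  sSup ((fun z => (1 - ‖z‖ ^ 2) ^ γ * ‖g z‖) '' unitDisk)

/-- Membership in the weighted Banach space `H^∞_{ν_β}`. -/
def MemWeighted (β : ℝ) (g : ℂ → ℂ) : Prop :=
  DifferentiableOn ℂ g unitDisk ∧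
    BddAbove ((fun z => (1 - ‖z‖ ^ 2) ^ β * ‖g z‖) '' unitDisk)

/-- Membership in the Bloch type space `B^α`. -/
def MemBloch (α : ℝ) (f : ℂ → ℂ) : Prop :=
  DifferentiableOn ℂ f unitDisk ∧
    BddAbove ((fun z => (1 - ‖z‖ ^ 2) ^ α * ‖deriv f z‖) '' unitDisk)

/-- The Bloch type norm `‖f‖_{B^α} = |f(0)| + sup_{z∈𝔻}(1-|z|²)^α |f'(z)|`. -/
def blochNorm (α : ℝ) (f : ℂ → ℂ) : ℝ :=
  ‖f 0‖ + wnorm α (deriv f)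

/-- Membership in the Zygmund type space `Z_β`. -/
def MemZygmund (β : ℝ) (f : ℂ → ℂ) : Prop :=
  DifferentiableOn ℂ f unitDisk ∧
    BddAbove ((fun z => (1 - ‖z‖ ^ 2) ^ β * ‖deriv (deriv f) z‖) '' unitDisk)

/-- The Zygmund type norm `‖f‖_{Z_β} = |f(0)| + |f'(0)| + sup_{z∈𝔻}(1-|z|²)^β |f''(z)|`. -/
def zygNorm (β : ℝ) (f : ℂ → ℂ) : ℝ :=
  ‖f 0‖ + ‖deriv f 0‖ + wnorm β (deriv (deriv f))

/-- The weighted composition operator `uC_φ f = u · (f ∘ φ)`. -/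
def wcomp (u φ f : ℂ → ℂ) : ℂ → ℂ := fun z => u z * f (φ z)

/-- `uC_φ` maps `B^α` boundedly into `Z_β`. -/
def BoundedBlochToZygmund (α β : ℝ) (u φ : ℂ → ℂ) : Prop :=
  (∀ f, MemBloch α f → MemZygmund β (wcomp u φ f)) ∧
    ∃ C > 0, ∀ f, MemBloch α f → zygNorm β (wcomp u φ f) ≤ C * blochNorm α f

/-- `uC_φ` maps `B^α` boundedly into `H^∞_{ν_β}`. -/
def BoundedBlochToWeighted (α β : ℝ) (u φ : ℂ → ℂ) : Prop :=
  (∀ f, MemBloch α f → MemWeighted β (wcomp u φ f)) ∧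
    ∃ C > 0, ∀ f, MemBloch α f → wnorm β (wcomp u φ f) ≤ C * blochNorm α f

/-- `uC_φ : B^α → Z_β` is compact: it is bounded and maps bounded sets of `B^α` to
totally bounded (equivalently, since `Z_β` is complete, relatively compact) subsets
of `Z_β`. -/
def CompactBlochToZygmund (α β : ℝ) (u φ : ℂ → ℂ) : Prop :=
  BoundedBlochToZygmund α β u φ ∧
    ∀ r : ℝ, ∀ ε : ℝ, 0 < ε → ∃ T : Finset (ℂ → ℂ),
      (∀ g ∈ T, MemZygmund β g) ∧
      ∀ f, MemBloch α f → blochNorm α f ≤ r →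
        ∃ g ∈ T, zygNorm β (fun z => wcomp u φ f z - g z) ≤ ε

/-- `uC_φ : B^α → H^∞_{ν_β}` is compact: it is bounded and maps bounded sets of `B^α`
to totally bounded (equivalently, relatively compact) subsets of `H^∞_{ν_β}`. -/
def CompactBlochToWeighted (α β : ℝ) (u φ : ℂ → ℂ) : Prop :=
  BoundedBlochToWeighted α β u φ ∧
    ∀ r : ℝ, ∀ ε : ℝ, 0 < ε → ∃ T : Finset (ℂ → ℂ),
      (∀ g ∈ T, MemWeighted β g) ∧
      ∀ f, MemBloch α f → blochNorm α f ≤ r →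
        ∃ g ∈ T, wnorm β (fun z => wcomp u φ f z - g z) ≤ ε

/-- A compact (linear, bounded, with totally bounded image of the unit ball) operator
from the subspace of `B^α` cut out by the predicate `P` into `Z_β`. -/
def IsCompactOpToZygmund (α β : ℝ) (P : (ℂ → ℂ) → Prop) (K : (ℂ → ℂ) → ℂ → ℂ) : Prop :=
  (∀ f g, P f → P g → ∀ a b : ℂ,
      K (fun z => a * f z + b * g z) = fun z => a * K f z + b * K g z) ∧
  (∀ f, P f → MemZygmund β (K f)) ∧
  (∃ C, ∀ f, P f → zygNorm β (K f) ≤ C * blochNorm α f) ∧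
  (∀ ε : ℝ, 0 < ε → ∃ T : Finset (ℂ → ℂ), (∀ g ∈ T, MemZygmund β g) ∧
      ∀ f, P f → blochNorm α f ≤ 1 → ∃ g ∈ T, zygNorm β (fun z => K f z - g z) ≤ ε)

/-- The essential norm of `uC_φ`, as an operator from the subspace of `B^α` cut out by
the predicate `P` into `Z_β`: the distance to the compact operators, the operator norm
being the supremum over the unit ball. -/
def essNormZ (α β : ℝ) (P : (ℂ → ℂ) → Prop) (u φ : ℂ → ℂ) : ℝ :=
  sInf {r | ∃ K, IsCompactOpToZygmund α β P K ∧
    r = sSup {s | ∃ f, P f ∧ blochNorm α f ≤ 1 ∧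
          s = zygNorm β (fun z => wcomp u φ f z - K f z)}}

/-- A compact (linear, bounded, with totally bounded image of the unit ball) operator
from `B^α` into `H^∞_{ν_β}`. -/
def IsCompactOpToWeighted (α β : ℝ) (K : (ℂ → ℂ) → ℂ → ℂ) : Prop :=
  (∀ f g, MemBloch α f → MemBloch α g → ∀ a b : ℂ,
      K (fun z => a * f z + b * g z) = fun z => a * K f z + b * K g z) ∧
  (∀ f, MemBloch α f → MemWeighted β (K f)) ∧
  (∃ C, ∀ f, MemBloch α f → wnorm β (K f) ≤ C * blochNorm α f) ∧
  (∀ ε : ℝ, 0 < ε → ∃ T : Finset (ℂ → ℂ), (∀ g ∈ T, MemWeighted β g) ∧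
      ∀ f, MemBloch α f → blochNorm α f ≤ 1 → ∃ g ∈ T, wnorm β (fun z => K f z - g z) ≤ ε)

/-- The essential norm of `uC_φ : B^α → H^∞_{ν_β}`. -/
def essNormW (α β : ℝ) (u φ : ℂ → ℂ) : ℝ :=
  sInf {r | ∃ K, IsCompactOpToWeighted α β K ∧
    r = sSup {s | ∃ f, MemBloch α f ∧ blochNorm α f ≤ 1 ∧
          s = wnorm β (fun z => wcomp u φ f z - K f z)}}

/-- `limsup_{|φ(z)|→1} F(z) = lim_{s→1⁻} sup {F z : z ∈ 𝔻, |φ z| > s}`.  Since the inner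
supremum is nonincreasing in `s`, the limit equals the infimum over `s ∈ [0,1)`; note
that `Real.sSup ∅ = 0`, matching the convention that the value is `0` when
`{z : |φ z| > s}` is empty for some `s < 1`. -/
def phiLimsup (φ : ℂ → ℂ) (F : ℂ → ℝ) : ℝ :=
  sInf ((fun s => sSup {y | ∃ z ∈ unitDisk, s < ‖φ z‖ ∧ y = F z}) '' Set.Ico (0:ℝ) 1)

/-! ### Weighted sup-norms on the disk -/

lemma mem_unitDisk {z : ℂ} : z ∈ unitDisk ↔ ‖z‖ < 1 := by simp [unitDisk]

lemma isOpen_unitDisk : IsOpen unitDisk := Metric.isOpen_ball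

lemma unitDisk_mem_nhds {z : ℂ} (hz : z ∈ unitDisk) : unitDisk ∈ nhds z :=
  isOpen_unitDisk.mem_nhds hz

lemma zero_mem_unitDisk : (0 : ℂ) ∈ unitDisk := by simp [mem_unitDisk]

lemma one_sub_norm_sq_pos {z : ℂ} (hz : z ∈ unitDisk) : 0 < 1 - ‖z‖ ^ 2 := by
  have := mem_unitDisk.1 hz
  nlinarith [norm_nonneg z]

lemma one_sub_norm_sq_le_one (z : ℂ) : 1 - ‖z‖ ^ 2 ≤ 1 := by
  nlinarith [sq_nonneg ‖z‖]

lemma wnorm_nonneg (γ : ℝ) (g : ℂ → ℂ) : 0 ≤ wnorm γ g := by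
  apply Real.sSup_nonneg
  rintro _ ⟨z, hz, rfl⟩
  have := one_sub_norm_sq_pos hz
  positivity

lemma wnorm_le {γ : ℝ} {g : ℂ → ℂ} {c : ℝ}
    (h : ∀ z ∈ unitDisk, (1 - ‖z‖ ^ 2) ^ γ * ‖g z‖ ≤ c) : wnorm γ g ≤ c := by
  apply csSup_le (Set.Nonempty.image _ ⟨0, zero_mem_unitDisk⟩)
  rintro _ ⟨z, hz, rfl⟩
  exact h z hz

lemma bddAbove_weighted {γ : ℝ} {g : ℂ → ℂ} {c : ℝ}
    (h : ∀ z ∈ unitDisk, (1 - ‖z‖ ^ 2) ^ γ * ‖g z‖ ≤ c) :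
    BddAbove ((fun z => (1 - ‖z‖ ^ 2) ^ γ * ‖g z‖) '' unitDisk) := by
  refine ⟨c, ?_⟩
  rintro _ ⟨z, hz, rfl⟩
  exact h z hz

lemma le_wnorm {γ : ℝ} {g : ℂ → ℂ}
    (h : BddAbove ((fun z => (1 - ‖z‖ ^ 2) ^ γ * ‖g z‖) '' unitDisk)) {z : ℂ}
    (hz : z ∈ unitDisk) : (1 - ‖z‖ ^ 2) ^ γ * ‖g z‖ ≤ wnorm γ g :=
  le_csSup h ⟨z, hz, rfl⟩

lemma zygNorm_nonneg (β : ℝ) (f : ℂ → ℂ) : 0 ≤ zygNorm β f := by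
  have := wnorm_nonneg β (deriv (deriv f))
  unfold zygNorm; positivity

lemma blochNorm_nonneg (α : ℝ) (f : ℂ → ℂ) : 0 ≤ blochNorm α f := by
  have := wnorm_nonneg α (deriv f)
  unfold blochNorm; positivity

lemma deriv_lin {f g : ℂ → ℂ} (hf : DifferentiableOn ℂ f unitDisk)
    (hg : DifferentiableOn ℂ g unitDisk) (a b : ℂ) {z : ℂ} (hz : z ∈ unitDisk) :
    deriv (fun z => a * f z + b * g z) z = a * deriv f z + b * deriv g z := by
  have h1 := (hf.differentiableAt (unitDisk_mem_nhds hz)).hasDerivAt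
  have h2 := (hg.differentiableAt (unitDisk_mem_nhds hz)).hasDerivAt
  exact ((h1.const_mul a).add (h2.const_mul b)).deriv

lemma deriv_deriv_lin {f g : ℂ → ℂ} (hf : DifferentiableOn ℂ f unitDisk)
    (hg : DifferentiableOn ℂ g unitDisk) (a b : ℂ) {z : ℂ} (hz : z ∈ unitDisk) :
    deriv (deriv (fun z => a * f z + b * g z)) z =
      a * deriv (deriv f) z + b * deriv (deriv g) z := by
  have h : deriv (fun z => a * f z + b * g z) =ᶠ[nhds z]
      fun z => a * deriv f z + b * deriv g z := by
    filter_upwards [unitDisk_mem_nhds hz] with y hy using deriv_lin hf hg a b hy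
  rw [h.deriv_eq]
  exact deriv_lin (hf.deriv isOpen_unitDisk) (hg.deriv isOpen_unitDisk) a b hz

lemma weight_mul_norm_lin_le {w A B : ℝ} (hw : 0 ≤ w) (a b x y : ℂ) (hx : w * ‖x‖ ≤ A)
    (hy : w * ‖y‖ ≤ B) : w * ‖a * x + b * y‖ ≤ ‖a‖ * A + ‖b‖ * B := by
  calc w * ‖a * x + b * y‖ ≤ w * (‖a‖ * ‖x‖ + ‖b‖ * ‖y‖) := by
        gcongr
        exact (norm_add_le _ _).trans (by simp)
    _ = ‖a‖ * (w * ‖x‖) + ‖b‖ * (w * ‖y‖) := by ring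
    _ ≤ _ := by gcongr

lemma MemZygmund.lin {β : ℝ} {f g : ℂ → ℂ} (hf : MemZygmund β f) (hg : MemZygmund β g)
    (a b : ℂ) : MemZygmund β (fun z => a * f z + b * g z) ∧
      zygNorm β (fun z => a * f z + b * g z) ≤ ‖a‖ * zygNorm β f + ‖b‖ * zygNorm β g := by
  have key : ∀ z ∈ unitDisk, (1 - ‖z‖ ^ 2) ^ β *
      ‖deriv (deriv (fun z => a * f z + b * g z)) z‖ ≤
      ‖a‖ * wnorm β (deriv (deriv f)) + ‖b‖ * wnorm β (deriv (deriv g)) := by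
    intro z hz
    rw [deriv_deriv_lin hf.1 hg.1 a b hz]
    exact weight_mul_norm_lin_le (Real.rpow_nonneg (one_sub_norm_sq_pos hz).le _) _ _ _ _
      (le_wnorm hf.2 hz) (le_wnorm hg.2 hz)
  refine ⟨⟨(hf.1.const_mul a).add (hg.1.const_mul b), bddAbove_weighted key⟩, ?_⟩
  have h0 := weight_mul_norm_lin_le zero_le_one a b (f 0) (g 0) (one_mul _).le (one_mul _).le
  have h1 := weight_mul_norm_lin_le zero_le_one a b (deriv f 0) (deriv g 0)
    (one_mul _).le (one_mul _).le
  have h2 := wnorm_le key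
  unfold zygNorm
  rw [deriv_lin hf.1 hg.1 a b zero_mem_unitDisk]
  linarith

lemma MemZygmund.sub {β : ℝ} {f g : ℂ → ℂ} (hf : MemZygmund β f) (hg : MemZygmund β g) :
    MemZygmund β (fun z => f z - g z) ∧
      zygNorm β (fun z => f z - g z) ≤ zygNorm β f + zygNorm β g := by
  have h := hf.lin hg 1 (-1)
  simpa [← sub_eq_add_neg] using h

lemma MemZygmund.add {β : ℝ} {f g : ℂ → ℂ} (hf : MemZygmund β f) (hg : MemZygmund β g) :
    MemZygmund β (fun z => f z + g z) ∧
      zygNorm β (fun z => f z + g z) ≤ zygNorm β f + zygNorm β g := by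
  simpa using hf.lin hg 1 1

lemma MemBloch.lin {α : ℝ} {f g : ℂ → ℂ} (hf : MemBloch α f) (hg : MemBloch α g)
    (a b : ℂ) : MemBloch α (fun z => a * f z + b * g z) ∧
      blochNorm α (fun z => a * f z + b * g z) ≤
        ‖a‖ * blochNorm α f + ‖b‖ * blochNorm α g := by
  have key : ∀ z ∈ unitDisk, (1 - ‖z‖ ^ 2) ^ α *
      ‖deriv (fun z => a * f z + b * g z) z‖ ≤
      ‖a‖ * wnorm α (deriv f) + ‖b‖ * wnorm α (deriv g) := by
    intro z hz
    rw [deriv_lin hf.1 hg.1 a b hz]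
    exact weight_mul_norm_lin_le (Real.rpow_nonneg (one_sub_norm_sq_pos hz).le _) _ _ _ _
      (le_wnorm hf.2 hz) (le_wnorm hg.2 hz)
  refine ⟨⟨(hf.1.const_mul a).add (hg.1.const_mul b), bddAbove_weighted key⟩, ?_⟩
  have h0 := weight_mul_norm_lin_le zero_le_one a b (f 0) (g 0) (one_mul _).le (one_mul _).le
  have h2 := wnorm_le key
  unfold blochNorm
  linarith

lemma MemBloch.sub {α : ℝ} {f g : ℂ → ℂ} (hf : MemBloch α f) (hg : MemBloch α g) :
    MemBloch α (fun z => f z - g z) := by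
  simpa [← sub_eq_add_neg] using (hf.lin hg 1 (-1)).1

lemma wcomp_lin (u φ f g : ℂ → ℂ) (a b : ℂ) :
    wcomp u φ (fun z => a * f z + b * g z) =
      fun z => a * wcomp u φ f z + b * wcomp u φ g z := by
  funext z; simp only [wcomp]; ring

/-- A holomorphic function whose derivative is bounded on the disk lies in `B^α`. -/
lemma memBloch_of_deriv_le {α : ℝ} (hα : 0 ≤ α) {f : ℂ → ℂ}
    (hf : DifferentiableOn ℂ f unitDisk) {c : ℝ} (h : ∀ z ∈ unitDisk, ‖deriv f z‖ ≤ c) :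
    MemBloch α f ∧ blochNorm α f ≤ ‖f 0‖ + c := by
  have key : ∀ z ∈ unitDisk, (1 - ‖z‖ ^ 2) ^ α * ‖deriv f z‖ ≤ c := by
    intro z hz
    have h1 := Real.rpow_le_one (one_sub_norm_sq_pos hz).le (one_sub_norm_sq_le_one z) hα
    calc _ ≤ 1 * ‖deriv f z‖ := by gcongr
      _ ≤ c := by simpa using h z hz
  exact ⟨⟨hf, bddAbove_weighted key⟩, by unfold blochNorm; gcongr; exact wnorm_le key⟩

/-! ### The second derivative of `u · (f ∘ φ)` -/

lemma deriv_wcomp {u φ f : ℂ → ℂ} (hu : DifferentiableOn ℂ u unitDisk)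
    (hφ : DifferentiableOn ℂ φ unitDisk) (hm : Set.MapsTo φ unitDisk unitDisk)
    (hf : DifferentiableOn ℂ f unitDisk) {z : ℂ} (hz : z ∈ unitDisk) :
    deriv (wcomp u φ f) z = deriv u z * f (φ z) + u z * (deriv f (φ z) * deriv φ z) := by
  have h1 := (hu.differentiableAt (unitDisk_mem_nhds hz)).hasDerivAt
  have h2 := (hφ.differentiableAt (unitDisk_mem_nhds hz)).hasDerivAt
  have h3 := (hf.differentiableAt (unitDisk_mem_nhds (hm hz))).hasDerivAt
  exact (h1.mul (h3.comp z h2)).deriv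

lemma deriv_deriv_wcomp {u φ f : ℂ → ℂ} (hu : DifferentiableOn ℂ u unitDisk)
    (hφ : DifferentiableOn ℂ φ unitDisk) (hm : Set.MapsTo φ unitDisk unitDisk)
    (hf : DifferentiableOn ℂ f unitDisk) {z : ℂ} (hz : z ∈ unitDisk) :
    deriv (deriv (wcomp u φ f)) z = deriv (deriv u) z * f (φ z) +
      (2 * deriv u z * deriv φ z + u z * deriv (deriv φ) z) * deriv f (φ z) +
      u z * deriv φ z ^ 2 * deriv (deriv f) (φ z) := by
  have h : deriv (wcomp u φ f) =ᶠ[nhds z]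
      fun z => deriv u z * f (φ z) + u z * (deriv f (φ z) * deriv φ z) := by
    filter_upwards [unitDisk_mem_nhds hz] with y hy using deriv_wcomp hu hφ hm hf hy
  rw [h.deriv_eq]
  have h1 := (hu.differentiableAt (unitDisk_mem_nhds hz)).hasDerivAt
  have h2 := (hφ.differentiableAt (unitDisk_mem_nhds hz)).hasDerivAt
  have h3 := (hf.differentiableAt (unitDisk_mem_nhds (hm hz))).hasDerivAt
  have h1' := ((hu.deriv isOpen_unitDisk).differentiableAt (unitDisk_mem_nhds hz)).hasDerivAt
  have h2' := ((hφ.deriv isOpen_unitDisk).differentiableAt (unitDisk_mem_nhds hz)).hasDerivAt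
  have h3' := ((hf.deriv isOpen_unitDisk).differentiableAt
    (unitDisk_mem_nhds (hm hz))).hasDerivAt
  have h4 := (h1'.mul (h3.comp z h2)).add (h1.mul ((h3'.comp z h2).mul h2'))
  refine (h4.deriv).trans ?_
  simp only [Function.comp_apply, Pi.mul_apply]
  ring

lemma memBloch_pow {α : ℝ} (hα : 0 ≤ α) (n : ℕ) : MemBloch α (fun z => z ^ n) := by
  refine (memBloch_of_deriv_le (c := n) hα (by fun_prop) fun z hz => ?_).1
  have := mem_unitDisk.1 hz
  simp only [deriv_pow_field, norm_mul, norm_pow, Complex.norm_natCast]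
  exact mul_le_of_le_one_right (by positivity) (pow_le_one₀ (norm_nonneg _) this.le)

/-- The three coefficient functions of `(u · f ∘ φ)''` are bounded against the weight. -/
lemma coeff_bounds {α β : ℝ} (hα : 0 ≤ α) {u φ : ℂ → ℂ}
    (hu : DifferentiableOn ℂ u unitDisk)
    (hφ : DifferentiableOn ℂ φ unitDisk) (hm : Set.MapsTo φ unitDisk unitDisk)
    (hb : BoundedBlochToZygmund α β u φ) : ∃ c : ℝ, ∀ z ∈ unitDisk,
      (1 - ‖z‖ ^ 2) ^ β * ‖deriv (deriv u) z‖ ≤ c ∧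
      (1 - ‖z‖ ^ 2) ^ β * ‖2 * deriv u z * deriv φ z + u z * deriv (deriv φ) z‖ ≤ c ∧
      (1 - ‖z‖ ^ 2) ^ β * ‖u z * deriv φ z ^ 2‖ ≤ c := by
  have H : ∀ n : ℕ, ∃ c : ℝ, ∀ z ∈ unitDisk, (1 - ‖z‖ ^ 2) ^ β *
      ‖deriv (deriv (wcomp u φ (fun z => z ^ n))) z‖ ≤ c := fun n =>
    ⟨_, fun z hz => le_wnorm (hb.1 _ (memBloch_pow hα n)).2 hz⟩
  obtain ⟨c0, h0⟩ := H 0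
  obtain ⟨c1, h1⟩ := H 1
  obtain ⟨c2, h2⟩ := H 2
  refine ⟨|c0| + (|c1| + |c0|) + (|c2| + 2 * (|c1| + |c0|) + |c0|), fun z hz => ?_⟩
  have hφz := (mem_unitDisk.1 (hm hz)).le
  have hw : 0 ≤ (1 - ‖z‖ ^ 2) ^ β := Real.rpow_nonneg (one_sub_norm_sq_pos hz).le _
  have e0 := h0 z hz
  have e1 := h1 z hz
  have e2 := h2 z hz
  have d2 : deriv (fun z : ℂ => z ^ 2) = fun z => 2 * z := by funext x; simp
  have d2' : deriv (fun z : ℂ => 2 * z) = fun z => 2 := by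
    funext x; simp
  rw [deriv_deriv_wcomp hu hφ hm (by fun_prop) hz] at e0 e1 e2
  rw [d2, d2'] at e2
  simp only [pow_zero, pow_one, deriv_const', deriv_id'', mul_zero, mul_one, add_zero] at e0 e1
  set w := (1 - ‖z‖ ^ 2) ^ β
  set D := deriv (deriv u) z
  set X := 2 * deriv u z * deriv φ z + u z * deriv (deriv φ) z
  set Y := u z * deriv φ z ^ 2
  have p1 : w * ‖D * φ z‖ ≤ w * ‖D‖ := by
    rw [norm_mul]; gcongr; exact mul_le_of_le_one_right (norm_nonneg _) hφz
  have p2 : w * ‖X * φ z‖ ≤ w * ‖X‖ := by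
    rw [norm_mul]; gcongr; exact mul_le_of_le_one_right (norm_nonneg _) hφz
  have p3 : w * ‖D * φ z ^ 2‖ ≤ w * ‖D‖ := by
    rw [norm_mul, norm_pow]; gcongr
    exact mul_le_of_le_one_right (norm_nonneg _) (pow_le_one₀ (norm_nonneg _) hφz)
  have q1 : w * ‖X‖ ≤ |c1| + |c0| := by
    have := weight_mul_norm_lin_le hw 1 (-1) _ _ e1 (p1.trans e0)
    simp only [one_mul, neg_mul, norm_one, norm_neg, add_neg_cancel_comm] at this
    linarith [le_abs_self c0, le_abs_self c1]
  have q2 : w * ‖Y‖ ≤ |c2| + 2 * (|c1| + |c0|) + |c0| := by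
    have a1 := weight_mul_norm_lin_le hw 1 (-1) _ _ e2 (p3.trans e0)
    have a2 := weight_mul_norm_lin_le hw 1 (-2) _ _ a1 (p2.trans q1)
    have a3 : w * ‖2 * Y‖ ≤ _ := le_trans (le_of_eq (by congr 2; ring)) a2
    simp only [norm_mul, norm_neg, norm_one, Complex.norm_two, one_mul] at a3
    have : 0 ≤ w * ‖Y‖ := by positivity
    linarith [le_abs_self c0, le_abs_self c2, abs_nonneg c1]
  refine ⟨?_, ?_, ?_⟩
  all_goals linarith [le_abs_self c0, abs_nonneg c0, abs_nonneg c1, abs_nonneg c2]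

/-! ### Comparison of `(n+1)^γ ρ^n` with `(1-ρ²)^{-γ}` -/

lemma exists_rpow_mul_pow_mul_rpow_le {γ : ℝ} (hγ : 0 < γ) : ∃ C : ℝ, 0 < C ∧
    ∀ (n : ℕ) (ρ : ℝ), 0 ≤ ρ → ρ < 1 →
      ((n : ℝ) + 1) ^ γ * ρ ^ n * (1 - ρ ^ 2) ^ γ ≤ C := by
  refine ⟨(2 * γ) ^ γ * Real.exp 1, by positivity, fun n ρ h0 h1 => ?_⟩
  set x := ((n : ℝ) + 1) * (1 - ρ) with hx
  have hx0 : 0 ≤ x := mul_nonneg (by positivity) (by linarith)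
  have hρ : ρ ^ n ≤ Real.exp 1 * Real.exp (-x) := by
    have : ρ ≤ Real.exp (-(1 - ρ)) := by
      have := Real.add_one_le_exp (-(1 - ρ)); linarith
    calc ρ ^ n ≤ Real.exp (-(1 - ρ)) ^ n := by gcongr
      _ = Real.exp (n * -(1 - ρ)) := (Real.exp_nat_mul _ _).symm
      _ ≤ Real.exp (1 + -x) := by
          apply Real.exp_le_exp.2
          rw [hx]; linarith
      _ = _ := Real.exp_add _ _
  have hxg : x ^ γ ≤ γ ^ γ * Real.exp x := by
    have h2 : x ≤ γ * Real.exp (x / γ) := by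
      have := Real.add_one_le_exp (x / γ)
      have : x / γ ≤ Real.exp (x / γ) := by linarith
      rwa [div_le_iff₀' hγ] at this
    calc x ^ γ ≤ (γ * Real.exp (x / γ)) ^ γ := Real.rpow_le_rpow hx0 h2 hγ.le
      _ = γ ^ γ * Real.exp x := by
          rw [Real.mul_rpow hγ.le (Real.exp_pos _).le, ← Real.exp_mul, div_mul_cancel₀ _ hγ.ne']
  have hsq : 0 ≤ 1 - ρ ^ 2 := by nlinarith
  calc ((n : ℝ) + 1) ^ γ * ρ ^ n * (1 - ρ ^ 2) ^ γ
      = (((n : ℝ) + 1) * (1 - ρ ^ 2)) ^ γ * ρ ^ n := by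
        rw [Real.mul_rpow (by positivity) hsq]; ring
    _ ≤ (2 * x) ^ γ * ρ ^ n := by
        refine mul_le_mul_of_nonneg_right (Real.rpow_le_rpow (by positivity) ?_ hγ.le)
          (by positivity)
        rw [hx]
        have : 1 - ρ ^ 2 ≤ 2 * (1 - ρ) := by nlinarith
        nlinarith [(n.cast_nonneg : (0 : ℝ) ≤ n)]
    _ ≤ (2 ^ γ * (γ ^ γ * Real.exp x)) * (Real.exp 1 * Real.exp (-x)) := by
        rw [Real.mul_rpow (by norm_num) hx0]
        gcongr
    _ = (2 * γ) ^ γ * Real.exp 1 * (Real.exp x * Real.exp (-x)) := by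
        rw [Real.mul_rpow (by norm_num) hγ.le]; ring
    _ = _ := by rw [← Real.exp_add]; simp

lemma exists_le_rpow_mul_pow (N : ℕ) : ∃ s : ℝ, 0 ≤ s ∧ s < 1 ∧ ∀ ρ : ℝ, s < ρ → ρ < 1 →
    ∃ n : ℕ, N ≤ n ∧ ∀ γ : ℝ, 0 < γ →
      1 ≤ 2 * 2 ^ γ * (1 - ρ ^ 2) ^ γ * (((n : ℝ) + 1) ^ γ * ρ ^ n) := by
  have hN : (0 : ℝ) < 1 / (2 * (N + 1)) := by positivity
  have hN1 : 1 / (2 * ((N : ℝ) + 1)) ≤ 1 := by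
    rw [div_le_one (by positivity)]
    linarith [(N.cast_nonneg : (0 : ℝ) ≤ N)]
  refine ⟨1 - 1 / (2 * (N + 1)), by linarith, by linarith, fun ρ h1 h2 => ?_⟩
  have hd : 0 < 1 - ρ := by linarith
  have hρ0 : 0 < ρ := by linarith
  have hy : 0 ≤ 1 / (2 * (1 - ρ)) := by positivity
  refine ⟨⌊1 / (2 * (1 - ρ))⌋₊, ?_, fun γ hγ => ?_⟩
  · apply Nat.le_floor
    rw [le_div_iff₀ (by positivity)]
    have : (1 - ρ) * (2 * (N + 1)) < 1 := by rw [← lt_div_iff₀ (by positivity)]; linarith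
    nlinarith
  · set n := ⌊1 / (2 * (1 - ρ))⌋₊ with hn
    have hn1 : (n : ℝ) ≤ 1 / (2 * (1 - ρ)) := Nat.floor_le hy
    have hn2 : 1 / (2 * (1 - ρ)) < n + 1 := Nat.lt_floor_add_one _
    rw [le_div_iff₀ (by positivity)] at hn1
    rw [div_lt_iff₀ (by positivity)] at hn2
    have hpow : 1 / 2 ≤ ρ ^ n := by
      have := one_add_mul_le_pow (a := -(1 - ρ)) (by linarith) n
      have h3 : 1 + -(1 - ρ) = ρ := by ring
      rw [h3] at this
      linarith
    have hsq : 0 < 1 - ρ ^ 2 := by nlinarith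
    have h4 : 1 ≤ 2 * ((1 - ρ ^ 2) * ((n : ℝ) + 1)) := by
      have : 1 - ρ ≤ 1 - ρ ^ 2 := by nlinarith
      nlinarith [(n.cast_nonneg : (0 : ℝ) ≤ n)]
    have h5 : 1 ≤ (2 * ((1 - ρ ^ 2) * ((n : ℝ) + 1))) ^ γ := Real.one_le_rpow h4 hγ.le
    rw [Real.mul_rpow (by norm_num) (by positivity), Real.mul_rpow hsq.le (by positivity)] at h5
    calc (1 : ℝ) ≤ (2 ^ γ * ((1 - ρ ^ 2) ^ γ * ((n : ℝ) + 1) ^ γ)) * (2 * ρ ^ n) := by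
          nlinarith
      _ = _ := by ring

lemma eventually_rpow_mul_wnorm_le {γ : ℝ} (hγ : 0 < γ) : ∃ C : ℝ, 0 < C ∧
    ∀ (β : ℝ) (φ G : ℂ → ℂ), Set.MapsTo φ unitDisk unitDisk → ∀ c s E δ : ℝ,
      (∀ z ∈ unitDisk, (1 - ‖z‖ ^ 2) ^ β * ‖G z‖ ≤ c) → 0 ≤ s → s < 1 → 0 ≤ E → 0 < δ →
      (∀ z ∈ unitDisk, s < ‖φ z‖ →
        (1 - ‖z‖ ^ 2) ^ β * ‖G z‖ ≤ E * (1 - ‖φ z‖ ^ 2) ^ γ) →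
      ∀ᶠ n : ℕ in Filter.atTop,
        ((n : ℝ) + 1) ^ γ * wnorm β (fun z => G z * φ z ^ n) ≤ C * E + δ := by
  obtain ⟨C, hC, hCle⟩ := exists_rpow_mul_pow_mul_rpow_le hγ
  refine ⟨C, hC, fun β φ G hm c s E δ hc hs0 hs1 hE hδ hG => ?_⟩
  have hlim : Filter.Tendsto (fun n : ℕ => ((n : ℝ) + 1) ^ γ * s ^ n * c) Filter.atTop
      (nhds 0) := by
    obtain ⟨k, hk⟩ := exists_nat_ge γ
    have hs : |s| < 1 := by rwa [abs_of_nonneg hs0]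
    have h1 : Filter.Tendsto (fun n : ℕ => (2:ℝ) ^ k * ((n : ℝ) ^ k * s ^ n) * |c|)
        Filter.atTop (nhds 0) := by
      simpa using ((tendsto_pow_const_mul_const_pow_of_abs_lt_one k hs).const_mul
        ((2:ℝ) ^ k)).mul_const |c|
    refine squeeze_zero_norm' ?_ h1
    filter_upwards [Filter.eventually_ge_atTop 1] with n hn
    have hn' : (1 : ℝ) ≤ n := by exact_mod_cast hn
    rw [norm_mul, norm_mul, Real.norm_eq_abs, Real.norm_eq_abs, Real.norm_eq_abs,
      abs_of_nonneg (by positivity), abs_of_nonneg (by positivity), ← mul_assoc, ← mul_pow]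
    gcongr
    calc ((n : ℝ) + 1) ^ γ ≤ ((n : ℝ) + 1) ^ (k : ℝ) :=
          Real.rpow_le_rpow_of_exponent_le (by linarith) hk
      _ = ((n : ℝ) + 1) ^ k := Real.rpow_natCast _ _
      _ ≤ (2 * (n : ℝ)) ^ k := by gcongr; linarith
  filter_upwards [hlim.eventually_le_const hδ] with n hn
  have hpos : 0 < ((n : ℝ) + 1) ^ γ := by positivity
  rw [← le_div_iff₀' hpos]
  apply wnorm_le
  intro z hz
  rw [le_div_iff₀' hpos, norm_mul, norm_pow]
  have hw : 0 ≤ (1 - ‖z‖ ^ 2) ^ β := Real.rpow_nonneg (one_sub_norm_sq_pos hz).le _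
  by_cases h : s < ‖φ z‖
  · calc ((n : ℝ) + 1) ^ γ * ((1 - ‖z‖ ^ 2) ^ β * (‖G z‖ * ‖φ z‖ ^ n))
        = ((n : ℝ) + 1) ^ γ * ‖φ z‖ ^ n * ((1 - ‖z‖ ^ 2) ^ β * ‖G z‖) := by ring
      _ ≤ ((n : ℝ) + 1) ^ γ * ‖φ z‖ ^ n * (E * (1 - ‖φ z‖ ^ 2) ^ γ) := by
          exact mul_le_mul_of_nonneg_left (hG z hz h) (by positivity)
      _ = (((n : ℝ) + 1) ^ γ * ‖φ z‖ ^ n * (1 - ‖φ z‖ ^ 2) ^ γ) * E := by ring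
      _ ≤ C * E := by
          gcongr; exact hCle n _ (norm_nonneg _) (mem_unitDisk.1 (hm hz))
      _ ≤ C * E + δ := by linarith
  · have hc0 : 0 ≤ c := le_trans (by positivity) (hc z hz)
    calc ((n : ℝ) + 1) ^ γ * ((1 - ‖z‖ ^ 2) ^ β * (‖G z‖ * ‖φ z‖ ^ n))
        = ((n : ℝ) + 1) ^ γ * ‖φ z‖ ^ n * ((1 - ‖z‖ ^ 2) ^ β * ‖G z‖) := by ring
      _ ≤ ((n : ℝ) + 1) ^ γ * s ^ n * c := by
          gcongr
          · exact not_lt.1 h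
          · exact hc z hz
      _ ≤ C * E + δ := by nlinarith

lemma weight_le_of_eventually {β γ : ℝ} (hγ : 0 < γ) {φ G : ℂ → ℂ} {c E : ℝ}
    (hm : Set.MapsTo φ unitDisk unitDisk)
    (hc : ∀ z ∈ unitDisk, (1 - ‖z‖ ^ 2) ^ β * ‖G z‖ ≤ c)
    (h : ∀ᶠ n : ℕ in Filter.atTop,
      ((n : ℝ) + 1) ^ γ * wnorm β (fun z => G z * φ z ^ n) ≤ E) :
    ∃ s : ℝ, 0 ≤ s ∧ s < 1 ∧ ∀ z ∈ unitDisk, s < ‖φ z‖ →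
      (1 - ‖z‖ ^ 2) ^ β * ‖G z‖ ≤ 2 * 2 ^ γ * E * (1 - ‖φ z‖ ^ 2) ^ γ := by
  obtain ⟨N, hN⟩ := Filter.eventually_atTop.1 h
  obtain ⟨s, hs0, hs1, hs⟩ := exists_le_rpow_mul_pow N
  refine ⟨s, hs0, hs1, fun z hz hsz => ?_⟩
  obtain ⟨n, hn, hle⟩ := hs ‖φ z‖ hsz (mem_unitDisk.1 (hm hz))
  have hw : 0 ≤ (1 - ‖z‖ ^ 2) ^ β := Real.rpow_nonneg (one_sub_norm_sq_pos hz).le _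
  have hv : 0 ≤ (1 - ‖φ z‖ ^ 2) ^ γ := Real.rpow_nonneg (one_sub_norm_sq_pos (hm hz)).le _
  have hbd : BddAbove ((fun z => (1 - ‖z‖ ^ 2) ^ β * ‖G z * φ z ^ n‖) '' unitDisk) := by
    refine bddAbove_weighted (c := c) fun y hy => (le_trans ?_ (hc y hy))
    have hw : 0 ≤ (1 - ‖y‖ ^ 2) ^ β := Real.rpow_nonneg (one_sub_norm_sq_pos hy).le _
    rw [norm_mul, norm_pow]
    gcongr
    exact mul_le_of_le_one_right (norm_nonneg _)
      (pow_le_one₀ (norm_nonneg _) (mem_unitDisk.1 (hm hy)).le)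
  have h1 := le_wnorm hbd hz
  rw [norm_mul, norm_pow] at h1
  calc (1 - ‖z‖ ^ 2) ^ β * ‖G z‖ ≤ ((1 - ‖z‖ ^ 2) ^ β * ‖G z‖) *
        (2 * 2 ^ γ * (1 - ‖φ z‖ ^ 2) ^ γ * (((n : ℝ) + 1) ^ γ * ‖φ z‖ ^ n)) :=
        le_mul_of_one_le_right (by positivity) (hle γ hγ)
    _ = 2 * 2 ^ γ * (((n : ℝ) + 1) ^ γ * ((1 - ‖z‖ ^ 2) ^ β * (‖G z‖ * ‖φ z‖ ^ n))) *
        (1 - ‖φ z‖ ^ 2) ^ γ := by ring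
    _ ≤ 2 * 2 ^ γ * (((n : ℝ) + 1) ^ γ * wnorm β (fun z => G z * φ z ^ n)) *
        (1 - ‖φ z‖ ^ 2) ^ γ := by gcongr
    _ ≤ _ := by gcongr; exact hN n hn

/-! ### Compact operators and null families -/

/-- A compact operator sends a bounded family of little-Bloch functions tending to zero locally
uniformly to a norm-null family (gliding hump argument). -/
lemma eventually_zygNorm_compact_lt {ι : Type*} {l : Filter ι} {α β : ℝ}
    {K : (ℂ → ℂ) → ℂ → ℂ} (hK : IsCompactOpToZygmund α β (MemBloch α) K) {F : ι → ℂ → ℂ}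
    (hF : ∀ᶠ j in l, MemBloch α (F j) ∧ blochNorm α (F j) ≤ 1)
    (hF0 : ∀ ε : ℝ, 0 < ε → ∀ᶠ j in l, ‖F j 0‖ ≤ ε)
    (hsmall : ∀ r ε : ℝ, r < 1 → 0 < ε → ∀ᶠ j in l, ∀ z ∈ unitDisk, ‖z‖ ≤ r →
      (1 - ‖z‖ ^ 2) ^ α * ‖deriv (F j) z‖ ≤ ε)
    (hlittle : ∀ᶠ j in l, ∀ ε : ℝ, 0 < ε → ∃ r < 1, ∀ z ∈ unitDisk, r < ‖z‖ →
      (1 - ‖z‖ ^ 2) ^ α * ‖deriv (F j) z‖ ≤ ε)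
    {δ : ℝ} (hδ : 0 < δ) : ∀ᶠ j in l, zygNorm β (K (F j)) < δ := by
  by_contra hcon
  obtain ⟨hlin, hmem, ⟨Ck, hCk⟩, htb⟩ := hK
  have hfr : ∃ᶠ j in l, δ ≤ zygNorm β (K (F j)) := by
    simpa only [Filter.Frequently, not_le] using hcon
  obtain ⟨T, hT, hTnet⟩ := htb (δ / 4) (by positivity)
  obtain ⟨g, hgT, hg⟩ : ∃ g ∈ T, ∃ᶠ j in l, δ ≤ zygNorm β (K (F j)) ∧
      zygNorm β (fun z => K (F j) z - g z) ≤ δ / 4 := by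
    by_contra! h
    have h' : ∀ᶠ j in l, ∀ g ∈ T, ¬ (δ ≤ zygNorm β (K (F j)) ∧
        zygNorm β (fun z => K (F j) z - g z) ≤ δ / 4) :=
      (Filter.eventually_all_finset T).2 fun g hg => by simpa using h g hg
    obtain ⟨j, hj1, ⟨hj2, hj3⟩, hj4⟩ := (hfr.and_eventually (hF.and h')).exists
    obtain ⟨g, hg1, hg2⟩ := hTnet _ hj2 hj3
    exact hj4 g hg1 ⟨hj1, hg2⟩
  have hgm := hT g hgT
  have hgδ : 3 * δ / 4 ≤ zygNorm β g := by
    obtain ⟨j, ⟨hj1, hj2⟩, hj3, -⟩ := (hg.and_eventually hF).exists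
    have := (((hmem _ hj3).sub hgm).1.add hgm).2
    simp only [sub_add_cancel] at this
    linarith
  have claim : ∀ N : ℕ, ∀ η : ℝ, 0 < η → ∃ f, MemBloch α f ∧ ‖f 0‖ ≤ 1 + η ∧
      (∀ z ∈ unitDisk, (1 - ‖z‖ ^ 2) ^ α * ‖deriv f z‖ ≤ 1 + η) ∧
      (∀ ε : ℝ, 0 < ε → ∃ r < 1, ∀ z ∈ unitDisk, r < ‖z‖ →
        (1 - ‖z‖ ^ 2) ^ α * ‖deriv f z‖ ≤ ε) ∧
      zygNorm β (fun z => K f z - N * g z) ≤ N * (δ / 4) := by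
    intro N
    induction N with
    | zero =>
      intro η hη
      have h0 : MemBloch α (fun _ => (0 : ℂ)) :=
        ⟨by fun_prop, bddAbove_weighted (c := 0) (by simp)⟩
      have hK0 := hlin _ _ h0 h0 0 0
      simp only [zero_mul, add_zero] at hK0
      refine ⟨fun _ => 0, h0, by simp; linarith, fun z _ => by simp; linarith,
        fun ε hε => ⟨0, by norm_num, fun z _ _ => by simp; linarith⟩, ?_⟩
      have hw : wnorm β (fun _ => 0) ≤ 0 := wnorm_le (by simp)
      rw [hK0]
      simpa [zygNorm] using hw
    | succ N ih =>
      intro η hη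
      obtain ⟨f, hf, hf0, hfC, hfl, hfK⟩ := ih (η / 2) (by positivity)
      obtain ⟨r, hr, hfr⟩ := hfl (η / 2) (by positivity)
      obtain ⟨j, ⟨-, hjg⟩, ⟨hjB, hj1⟩, hj0, hjs, hjl⟩ := (hg.and_eventually (hF.and
        ((hF0 (η / 2) (by positivity)).and ((hsmall r (η / 2) hr (by positivity)).and
          hlittle)))).exists
      have hjC : ∀ z ∈ unitDisk, (1 - ‖z‖ ^ 2) ^ α * ‖deriv (F j) z‖ ≤ 1 := fun z hz => by
        have := le_wnorm hjB.2 hz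
        have h2 : wnorm α (deriv (F j)) ≤ blochNorm α (F j) := by
          simp [blochNorm]
        linarith
      have hder : ∀ z ∈ unitDisk, ∀ A B : ℝ, (1 - ‖z‖ ^ 2) ^ α * ‖deriv f z‖ ≤ A →
          (1 - ‖z‖ ^ 2) ^ α * ‖deriv (F j) z‖ ≤ B →
          (1 - ‖z‖ ^ 2) ^ α * ‖deriv (fun z => 1 * f z + 1 * F j z) z‖ ≤ A + B := by
        intro z hz A B hA hB
        rw [deriv_lin hf.1 hjB.1 1 1 hz]
        simpa using weight_mul_norm_lin_le
          (Real.rpow_nonneg (one_sub_norm_sq_pos hz).le _) 1 1 _ _ hA hB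
      refine ⟨fun z => 1 * f z + 1 * F j z, (hf.lin hjB 1 1).1, ?_, ?_, ?_, ?_⟩
      · simp only [one_mul]
        exact (norm_add_le _ _).trans (by linarith)
      · intro z hz
        by_cases h : ‖z‖ ≤ r
        · exact (hder z hz _ _ (hfC z hz) (hjs z hz h)).trans (by linarith)
        · exact (hder z hz _ _ (hfr z hz (not_le.1 h)) (hjC z hz)).trans (by linarith)
      · intro ε hε
        obtain ⟨r1, hr1, h1⟩ := hfl (ε / 2) (by positivity)
        obtain ⟨r2, hr2, h2⟩ := hjl (ε / 2) (by positivity)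
        refine ⟨max r1 r2, max_lt hr1 hr2, fun z hz hzr => ?_⟩
        exact (hder z hz _ _ (h1 z hz ((le_max_left _ _).trans_lt hzr))
          (h2 z hz ((le_max_right _ _).trans_lt hzr))).trans (by linarith)
      · rw [hlin _ _ hf hjB]
        have hNg : MemZygmund β (fun z => (N : ℂ) * g z) := by
          simpa using (hgm.lin hgm N 0).1
        have := (((hmem f hf).sub hNg).1.add ((hmem _ hjB).sub hgm).1).2
        have heq : (fun z => 1 * K f z + 1 * K (F j) z - ((N + 1 : ℕ) : ℂ) * g z) =
            fun z => (K f z - N * g z) + (K (F j) z - g z) := by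
          funext z; push_cast; ring
        rw [heq]
        push_cast
        linarith
  obtain ⟨N, hN⟩ := exists_nat_gt (8 * |Ck| / δ)
  have hN0 : (0 : ℝ) < N := lt_of_le_of_lt (by positivity) hN
  obtain ⟨f, hf, hf0, hfC, -, hfK⟩ := claim N 1 one_pos
  have hfB : blochNorm α f ≤ 4 := by
    have := wnorm_le hfC
    unfold blochNorm; linarith
  have hKf : zygNorm β (K f) ≤ |Ck| * 4 := by
    refine (hCk f hf).trans ?_
    have := blochNorm_nonneg α f
    calc Ck * blochNorm α f ≤ |Ck| * blochNorm α f := by gcongr; exact le_abs_self _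
      _ ≤ _ := by gcongr
  have hNg : MemZygmund β (fun z => (N : ℂ) * g z) := by
    simpa using (hgm.lin hgm N 0).1
  have h1 := ((hmem f hf).lin ((hmem f hf).sub hNg).1 (N : ℂ)⁻¹ (-(N : ℂ)⁻¹)).2
  have hNc : (N : ℂ) ≠ 0 := by exact_mod_cast hN0.ne'
  have heq : (fun z => (N : ℂ)⁻¹ * K f z + -(N : ℂ)⁻¹ * (K f z - N * g z)) = g := by
    funext z; field_simp; ring
  rw [heq, norm_neg, norm_inv, Complex.norm_natCast] at h1
  have h2 : zygNorm β g ≤ (N : ℝ)⁻¹ * (|Ck| * 4) + (N : ℝ)⁻¹ * (N * (δ / 4)) := by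
    refine h1.trans ?_
    gcongr
  rw [inv_mul_cancel_left₀ hN0.ne'] at h2
  rw [div_lt_iff₀ hδ] at hN
  have h3 : (N : ℝ)⁻¹ * (|Ck| * 4) < δ / 2 := by
    rw [inv_mul_lt_iff₀ hN0]; linarith
  linarith

/-! ### Test functions -/

/-- The filter of points of the disk approaching the unit circle. -/
def toCircle : Filter ℂ := Filter.comap norm (nhdsWithin 1 (Set.Iio 1))

lemma eventually_toCircle {P : ℂ → Prop} :
    (∀ᶠ w in toCircle, P w) ↔ ∃ s : ℝ, s < 1 ∧ ∀ w, s < ‖w‖ → ‖w‖ < 1 → P w := by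
  rw [toCircle, Filter.eventually_comap, Filter.Eventually, mem_nhdsLT_iff_exists_Ioo_subset]
  constructor
  · rintro ⟨s, hs, h⟩
    exact ⟨s, hs, fun w h1 h2 => h ⟨h1, h2⟩ w rfl⟩
  · rintro ⟨s, hs, h⟩
    exact ⟨s, hs, fun t ht w hw => h w (hw ▸ ht.1) (hw ▸ ht.2)⟩

lemma exists_rpow_mul_le {c : ℝ} (hc : 0 < c) (M : ℝ) {ε : ℝ} (hε : 0 < ε) :
    ∃ s : ℝ, s < 1 ∧ ∀ t : ℝ, s < t → t < 1 → (1 - t ^ 2) ^ c * M ≤ ε := by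
  have hcont : Continuous fun t : ℝ => (1 - t ^ 2) ^ c * M :=
    ((by fun_prop : Continuous fun t : ℝ => 1 - t ^ 2).rpow_const
      fun _ => Or.inr hc.le).mul continuous_const
  have h := hcont.tendsto 1
  simp only [one_pow, sub_self, Real.zero_rpow hc.ne', zero_mul] at h
  have h2 := (h.mono_left (nhdsWithin_le_nhds (s := Set.Iio 1))).eventually_le_const hε
  rw [Filter.Eventually, mem_nhdsLT_iff_exists_Ioo_subset] at h2
  obtain ⟨s, hs, h⟩ := h2
  exact ⟨s, hs, fun t h1 h2 => h ⟨h1, h2⟩⟩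

/-- The test function `κ (1-|w|²)^{a+1-α} (1 - conj w · z)^{-a}`. -/
def testFn (κ α a : ℝ) (w z : ℂ) : ℂ :=
  ((κ * (1 - ‖w‖ ^ 2) ^ (a + 1 - α) : ℝ) : ℂ) *
    (1 - (starRingEnd ℂ) w * z) ^ (-(a : ℂ))

lemma norm_conj_mul_lt {w z : ℂ} (hw : w ∈ unitDisk) (hz : z ∈ unitDisk) :
    ‖(starRingEnd ℂ) w * z‖ < 1 := by
  rw [norm_mul, RCLike.norm_conj]
  have := mem_unitDisk.1 hw
  have := mem_unitDisk.1 hz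
  nlinarith [norm_nonneg w, norm_nonneg z]

lemma one_sub_conj_mul_mem_slitPlane {w z : ℂ} (hw : w ∈ unitDisk) (hz : z ∈ unitDisk) :
    1 - (starRingEnd ℂ) w * z ∈ Complex.slitPlane := by
  left
  have h1 := norm_conj_mul_lt hw hz
  have h2 := Complex.re_le_norm ((starRingEnd ℂ) w * z)
  rw [Complex.sub_re, Complex.one_re]
  linarith

lemma hasDerivAt_one_sub_conj_cpow {w z : ℂ} (hw : w ∈ unitDisk) (hz : z ∈ unitDisk)
    (a : ℝ) : HasDerivAt (fun z => (1 - (starRingEnd ℂ) w * z) ^ (-(a : ℂ)))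
      (a * (starRingEnd ℂ) w * (1 - (starRingEnd ℂ) w * z) ^ (-((a + 1 : ℝ) : ℂ))) z := by
  have h1 : HasDerivAt (fun z => 1 - (starRingEnd ℂ) w * z) (-((starRingEnd ℂ) w)) z := by
    simpa using ((hasDerivAt_id z).const_mul ((starRingEnd ℂ) w)).const_sub 1
  convert h1.cpow_const (c := -(a : ℂ)) (one_sub_conj_mul_mem_slitPlane hw hz) using 1
  have : -((a + 1 : ℝ) : ℂ) = -(a : ℂ) - 1 := by push_cast; ring
  rw [this]; ring

lemma norm_one_sub_conj_cpow {w z : ℂ} (hw : w ∈ unitDisk) (hz : z ∈ unitDisk) (a : ℝ) :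
    ‖(1 - (starRingEnd ℂ) w * z) ^ (-(a : ℂ))‖ = ‖1 - (starRingEnd ℂ) w * z‖ ^ (-a) := by
  have h := Complex.norm_cpow_of_ne_zero
    (Complex.slitPlane_ne_zero (one_sub_conj_mul_mem_slitPlane hw hz)) (-(a : ℂ))
  simpa using h

lemma differentiableOn_testFn (κ α a : ℝ) {w : ℂ} (hw : w ∈ unitDisk) :
    DifferentiableOn ℂ (testFn κ α a w) unitDisk := fun _ hz =>
  (((hasDerivAt_one_sub_conj_cpow hw hz a).const_mul _).differentiableAt).differentiableWithinAt

lemma deriv_testFn (κ α a : ℝ) {w z : ℂ} (hw : w ∈ unitDisk) (hz : z ∈ unitDisk) :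
    deriv (testFn κ α a w) z = ((κ * (1 - ‖w‖ ^ 2) ^ (a + 1 - α) : ℝ) : ℂ) *
      (a * (starRingEnd ℂ) w * (1 - (starRingEnd ℂ) w * z) ^ (-((a + 1 : ℝ) : ℂ))) :=
  ((hasDerivAt_one_sub_conj_cpow hw hz a).const_mul _).deriv

lemma deriv_deriv_testFn (κ α a : ℝ) {w z : ℂ} (hw : w ∈ unitDisk) (hz : z ∈ unitDisk) :
    deriv (deriv (testFn κ α a w)) z = ((κ * (1 - ‖w‖ ^ 2) ^ (a + 1 - α) : ℝ) : ℂ) *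
      (a * (starRingEnd ℂ) w * (((a + 1 : ℝ) : ℂ) * (starRingEnd ℂ) w *
        (1 - (starRingEnd ℂ) w * z) ^ (-((a + 1 + 1 : ℝ) : ℂ)))) := by
  have h : deriv (testFn κ α a w) =ᶠ[nhds z] fun z =>
      ((κ * (1 - ‖w‖ ^ 2) ^ (a + 1 - α) : ℝ) : ℂ) *
      (a * (starRingEnd ℂ) w * (1 - (starRingEnd ℂ) w * z) ^ (-((a + 1 : ℝ) : ℂ))) := by
    filter_upwards [unitDisk_mem_nhds hz] with y hy using deriv_testFn κ α a hw hy
  rw [h.deriv_eq]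
  exact (((hasDerivAt_one_sub_conj_cpow hw hz (a + 1)).const_mul _).const_mul _).deriv

lemma one_sub_conj_mul_self_cpow {w : ℂ} (hw : w ∈ unitDisk) (a : ℝ) :
    (1 - (starRingEnd ℂ) w * w) ^ (-(a : ℂ)) = (((1 - ‖w‖ ^ 2) ^ (-a) : ℝ) : ℂ) := by
  rw [Complex.ofReal_cpow (one_sub_norm_sq_pos hw).le]
  push_cast
  rw [← Complex.conj_mul']

lemma weight_mul_norm_deriv_testFn {κ α a : ℝ} (hκ : 0 ≤ κ) (ha : 0 ≤ a) {w z : ℂ}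
    (hw : w ∈ unitDisk) (hz : z ∈ unitDisk) :
    (1 - ‖z‖ ^ 2) ^ α * ‖deriv (testFn κ α a w) z‖ ≤ κ * a *
      ((1 - ‖z‖ ^ 2) ^ α * (1 - ‖w‖ ^ 2) ^ (a + 1 - α) *
        ‖1 - (starRingEnd ℂ) w * z‖ ^ (-(a + 1))) := by
  have h1 := one_sub_norm_sq_pos hw
  have h2 := one_sub_norm_sq_pos hz
  have h3 := (mem_unitDisk.1 hw).le
  rw [deriv_testFn κ α a hw hz, norm_mul, norm_mul, norm_mul, norm_one_sub_conj_cpow hw hz,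
    Complex.norm_real, Complex.norm_real, RCLike.norm_conj, Real.norm_of_nonneg ha,
    Real.norm_of_nonneg (by positivity)]
  calc _ = (κ * a * ((1 - ‖z‖ ^ 2) ^ α * (1 - ‖w‖ ^ 2) ^ (a + 1 - α) *
        ‖1 - (starRingEnd ℂ) w * z‖ ^ (-(a + 1)))) * ‖w‖ := by ring
    _ ≤ _ := mul_le_of_le_one_right (by positivity) h3

lemma one_sub_norm_le_left {w z : ℂ} (hz : z ∈ unitDisk) :
    1 - ‖w‖ ≤ ‖1 - (starRingEnd ℂ) w * z‖ := by
  have h := norm_sub_norm_le (1 : ℂ) ((starRingEnd ℂ) w * z)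
  rw [norm_one, norm_mul, RCLike.norm_conj] at h
  have := mem_unitDisk.1 hz
  nlinarith [norm_nonneg w]

lemma one_sub_norm_le_right {w z : ℂ} (hw : w ∈ unitDisk) :
    1 - ‖z‖ ≤ ‖1 - (starRingEnd ℂ) w * z‖ := by
  have h := norm_sub_norm_le (1 : ℂ) ((starRingEnd ℂ) w * z)
  rw [norm_one, norm_mul, RCLike.norm_conj] at h
  have := mem_unitDisk.1 hw
  nlinarith [norm_nonneg z]

lemma memBloch_testFn {κ α a : ℝ} (hκ : 0 ≤ κ) (hα : 0 ≤ α) (ha : α ≤ a)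
    (hκa : κ * (1 + a * 2 ^ (a + 1)) ≤ 1) {w : ℂ} (hw : w ∈ unitDisk) :
    MemBloch α (testFn κ α a w) ∧ blochNorm α (testFn κ α a w) ≤ 1 := by
  have key : ∀ z ∈ unitDisk, (1 - ‖z‖ ^ 2) ^ α * ‖deriv (testFn κ α a w) z‖ ≤
      κ * a * 2 ^ (a + 1) := by
    intro z hz
    refine (weight_mul_norm_deriv_testFn hκ (hα.trans ha) hw hz).trans ?_
    have ha0 := hα.trans ha
    have h1 := one_sub_norm_sq_pos hw
    have h2 := one_sub_norm_sq_pos hz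
    have hwl := mem_unitDisk.1 hw
    have hzl := mem_unitDisk.1 hz
    set m := ‖1 - (starRingEnd ℂ) w * z‖ with hm
    have h3 : 1 - ‖w‖ ≤ m := one_sub_norm_le_left hz
    have h4 : 1 - ‖z‖ ≤ m := one_sub_norm_le_right hw
    have hm0 : 0 < m := by linarith
    have h5 : 1 - ‖w‖ ^ 2 ≤ 2 * m := by nlinarith [norm_nonneg w]
    have h6 : 1 - ‖z‖ ^ 2 ≤ 2 * m := by nlinarith [norm_nonneg z]
    have h7 : (1 - ‖z‖ ^ 2) ^ α * (1 - ‖w‖ ^ 2) ^ (a + 1 - α) ≤ 2 ^ (a + 1) * m ^ (a + 1) := by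
      calc _ ≤ (2 * m) ^ α * (2 * m) ^ (a + 1 - α) :=
            mul_le_mul (Real.rpow_le_rpow h2.le h6 hα)
              (Real.rpow_le_rpow h1.le h5 (by linarith)) (by positivity) (by positivity)
        _ = (2 * m) ^ (a + 1) := by
            rw [← Real.rpow_add (by positivity)]; congr 1; ring
        _ = _ := Real.mul_rpow (by norm_num) hm0.le
    have hmm : m ^ (a + 1) * m ^ (-(a + 1)) = 1 := by
      rw [← Real.rpow_add hm0]; simp
    refine mul_le_mul_of_nonneg_left ?_ (by positivity)
    calc _ ≤ 2 ^ (a + 1) * m ^ (a + 1) * m ^ (-(a + 1)) := by gcongr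
      _ = _ := by rw [mul_assoc, hmm, mul_one]
  refine ⟨⟨differentiableOn_testFn κ α a hw, bddAbove_weighted key⟩, ?_⟩
  have h0 : ‖testFn κ α a w 0‖ ≤ κ := by
    have h1 := one_sub_norm_sq_pos hw
    simp only [testFn, mul_zero, sub_zero, Complex.one_cpow, mul_one]
    rw [Complex.norm_real, Real.norm_of_nonneg (by positivity)]
    exact mul_le_of_le_one_right hκ
      (Real.rpow_le_one h1.le (one_sub_norm_sq_le_one w) (by linarith))
  have := wnorm_le key
  unfold blochNorm
  linarith

lemma eventually_zygNorm_compact_testFn_lt {κ α β a : ℝ} (hκ : 0 ≤ κ) (hα : 0 < α)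
    (ha : α ≤ a) (hκa : κ * (1 + a * 2 ^ (a + 1)) ≤ 1) {K : (ℂ → ℂ) → ℂ → ℂ}
    (hK : IsCompactOpToZygmund α β (MemBloch α) K) {δ : ℝ} (hδ : 0 < δ) :
    ∀ᶠ w in toCircle, zygNorm β (K (testFn κ α a w)) < δ := by
  have ha0 : 0 < a := hα.trans_le ha
  refine eventually_zygNorm_compact_lt hK ?_ ?_ ?_ ?_ hδ
  · exact eventually_toCircle.2 ⟨0, one_pos, fun w _ hw =>
      memBloch_testFn hκ hα.le ha hκa (mem_unitDisk.2 hw)⟩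
  · intro ε hε
    obtain ⟨s, hs, h⟩ := exists_rpow_mul_le (c := a + 1 - α) (by linarith) κ hε
    refine eventually_toCircle.2 ⟨s, hs, fun w h1 h2 => ?_⟩
    have h3 := one_sub_norm_sq_pos (mem_unitDisk.2 h2)
    simp only [testFn, mul_zero, sub_zero, Complex.one_cpow, mul_one]
    rw [Complex.norm_real, Real.norm_of_nonneg (by positivity), mul_comm]
    exact h _ h1 h2
  · intro r ε hr hε
    obtain ⟨s, hs, h⟩ := exists_rpow_mul_le (c := a + 1 - α) (by linarith)
      (κ * a * (1 - r) ^ (-(a + 1))) hε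
    refine eventually_toCircle.2 ⟨s, hs, fun w h1 h2 z hz hzr => ?_⟩
    have hw := mem_unitDisk.2 h2
    refine (weight_mul_norm_deriv_testFn hκ ha0.le hw hz).trans (le_trans ?_ (h _ h1 h2))
    have h3 := one_sub_norm_sq_pos hw
    have h4 := one_sub_norm_sq_pos hz
    have h5 := one_sub_norm_le_right (z := z) hw
    have h6 : ‖1 - (starRingEnd ℂ) w * z‖ ^ (-(a + 1)) ≤ (1 - r) ^ (-(a + 1)) :=
      Real.rpow_le_rpow_of_nonpos (by linarith) (by linarith) (by linarith)
    have h7 := Real.rpow_le_one h4.le (one_sub_norm_sq_le_one z) hα.le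
    calc _ ≤ κ * a * (1 * (1 - ‖w‖ ^ 2) ^ (a + 1 - α) * (1 - r) ^ (-(a + 1))) := by gcongr
      _ = _ := by ring
  · refine eventually_toCircle.2 ⟨0, one_pos, fun w _ h2 ε hε => ?_⟩
    have hw := mem_unitDisk.2 h2
    obtain ⟨s, hs, h⟩ := exists_rpow_mul_le hα (κ * a * (1 - ‖w‖) ^ (-(a + 1))) hε
    refine ⟨s, hs, fun z hz hzs => ?_⟩
    refine (weight_mul_norm_deriv_testFn hκ ha0.le hw hz).trans
      (le_trans ?_ (h _ hzs (mem_unitDisk.1 hz)))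
    have h3 := one_sub_norm_sq_pos hw
    have h4 := one_sub_norm_sq_pos hz
    have h5 := one_sub_norm_le_left (w := w) hz
    have h6 : ‖1 - (starRingEnd ℂ) w * z‖ ^ (-(a + 1)) ≤ (1 - ‖w‖) ^ (-(a + 1)) :=
      Real.rpow_le_rpow_of_nonpos (by linarith) (by linarith) (by linarith)
    have h7 := Real.rpow_le_one h3.le (one_sub_norm_sq_le_one w)
      (by linarith : 0 ≤ a + 1 - α)
    calc _ ≤ κ * a * ((1 - ‖z‖ ^ 2) ^ α * 1 * (1 - ‖w‖) ^ (-(a + 1))) := by gcongr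
      _ = _ := by ring

/-! ### Lower estimate -/

lemma exists_weight_test_le {κ α β a : ℝ} (hκ : 0 < κ) (hα : 0 < α) (ha : α ≤ a)
    (hκa : κ * (1 + a * 2 ^ (a + 1)) ≤ 1) {u φ : ℂ → ℂ}
    (hu : DifferentiableOn ℂ u unitDisk) (hφ : DifferentiableOn ℂ φ unitDisk)
    (hm : Set.MapsTo φ unitDisk unitDisk) (hb : BoundedBlochToZygmund α β u φ)
    {K : (ℂ → ℂ) → ℂ → ℂ} (hK : IsCompactOpToZygmund α β (MemBloch α) K) {L : ℝ}
    (hL : ∀ f, MemBloch α f → blochNorm α f ≤ 1 →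
      zygNorm β (fun z => wcomp u φ f z - K f z) ≤ L) {δ : ℝ} (hδ : 0 < δ) :
    ∃ s : ℝ, s < 1 ∧ ∀ z ∈ unitDisk, s < ‖φ z‖ → (1 - ‖z‖ ^ 2) ^ β *
      ‖deriv (deriv u) z * (((1 - ‖φ z‖ ^ 2) ^ (1 - α) : ℝ) : ℂ) +
        a * ((2 * deriv u z * deriv φ z + u z * deriv (deriv φ) z) *
          (starRingEnd ℂ) (φ z) * (((1 - ‖φ z‖ ^ 2) ^ (-α) : ℝ) : ℂ)) +
        a * (a + 1) * (u z * deriv φ z ^ 2 * (starRingEnd ℂ) (φ z) ^ 2 *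
          (((1 - ‖φ z‖ ^ 2) ^ (-α - 1) : ℝ) : ℂ))‖ ≤ κ⁻¹ * (L + δ) := by
  obtain ⟨s, hs1, hs⟩ :=
    eventually_toCircle.1 (eventually_zygNorm_compact_testFn_lt hκ.le hα ha hκa hK hδ)
  refine ⟨s, hs1, fun z hz hsz => ?_⟩
  have hw := hm hz
  have hwl := mem_unitDisk.1 hw
  obtain ⟨hfm, hf1⟩ := memBloch_testFn hκ.le hα.le ha hκa hw
  have h1 := hs _ hsz hwl
  have h2 := hL _ hfm hf1
  have hWm := hb.1 _ hfm
  have hKm := hK.2.1 _ hfm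
  have h3 := ((hWm.sub hKm).1.add hKm).2
  simp only [sub_add_cancel] at h3
  have h4 := le_wnorm hWm.2 hz
  have h5 : wnorm β (deriv (deriv (wcomp u φ (testFn κ α a (φ z))))) ≤
      zygNorm β (wcomp u φ (testFn κ α a (φ z))) := by
    unfold zygNorm
    linarith [norm_nonneg (wcomp u φ (testFn κ α a (φ z)) 0),
      norm_nonneg (deriv (wcomp u φ (testFn κ α a (φ z))) 0)]
  have h6 := h4.trans (h5.trans (h3.trans (by linarith : _ ≤ L + δ)))
  rw [le_inv_mul_iff₀ hκ]
  refine le_trans (le_of_eq ?_) h6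
  have hy := one_sub_norm_sq_pos hw
  rw [deriv_deriv_wcomp hu hφ hm (differentiableOn_testFn κ α a hw) hz,
    deriv_testFn κ α a hw hw, deriv_deriv_testFn κ α a hw hw, testFn,
    one_sub_conj_mul_self_cpow hw, one_sub_conj_mul_self_cpow hw, one_sub_conj_mul_self_cpow hw]
  set y := 1 - ‖φ z‖ ^ 2
  have e1 : y ^ (1 - α) = y ^ (a + 1 - α) * y ^ (-a) := by
    rw [← Real.rpow_add hy]; congr 1; ring
  have e2 : y ^ (-α) = y ^ (a + 1 - α) * y ^ (-(a + 1)) := by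
    rw [← Real.rpow_add hy]; congr 1; ring
  have e3 : y ^ (-α - 1) = y ^ (a + 1 - α) * y ^ (-(a + 1 + 1)) := by
    rw [← Real.rpow_add hy]; congr 1; ring
  rw [e1, e2, e3]
  have hκn : κ = ‖(κ : ℂ)‖ := by rw [Complex.norm_real, Real.norm_of_nonneg hκ.le]
  rw [mul_left_comm]
  nth_rewrite 1 [hκn]
  rw [← norm_mul]
  congr 2
  push_cast
  ring

/-- Second differences in the exponent isolate each of three terms. -/
lemma weight_norm_le_of_three {w E α : ℝ} (hw : 0 ≤ w) (hα : 0 ≤ α) {p q s : ℂ}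
    (h : ∀ i : ℕ, i < 3 → w * ‖p + ((α + i : ℝ) : ℂ) * q +
      ((α + i : ℝ) : ℂ) * (((α + i : ℝ) : ℂ) + 1) * s‖ ≤ E) :
    w * ‖s‖ ≤ 2 * E ∧ w * ‖q‖ ≤ (4 * α + 6) * E ∧
      w * ‖p‖ ≤ (1 + α * (4 * α + 6) + 2 * (α * (α + 1))) * E := by
  have h0 := h 0 (by norm_num)
  have h1 := h 1 (by norm_num)
  have h2 := h 2 (by norm_num)
  set v0 := p + ((α + (0 : ℕ) : ℝ) : ℂ) * q +
      ((α + (0 : ℕ) : ℝ) : ℂ) * (((α + (0 : ℕ) : ℝ) : ℂ) + 1) * s with hv0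
  set v1 := p + ((α + (1 : ℕ) : ℝ) : ℂ) * q +
      ((α + (1 : ℕ) : ℝ) : ℂ) * (((α + (1 : ℕ) : ℝ) : ℂ) + 1) * s with hv1
  set v2 := p + ((α + (2 : ℕ) : ℝ) : ℂ) * q +
      ((α + (2 : ℕ) : ℝ) : ℂ) * (((α + (2 : ℕ) : ℝ) : ℂ) + 1) * s with hv2
  have hE : 0 ≤ E := le_trans (by positivity) h0
  have hs : s = (1 / 2 : ℂ) * (1 * v2 + 1 * v0) + (-1) * v1 := by
    rw [hv0, hv1, hv2]; push_cast; ring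
  have hq : q = 1 * (1 * v1 + (-1) * v0) + (-(2 * (α + 1) : ℝ) : ℂ) * s := by
    rw [hv0, hv1]; push_cast; ring
  have hp : p = 1 * (1 * v0 + (-(α : ℝ) : ℂ) * q) + (-(α * (α + 1) : ℝ) : ℂ) * s := by
    rw [hv0]; push_cast; ring
  have a1 : w * ‖s‖ ≤ 2 * E := by
    have := weight_mul_norm_lin_le hw (1 / 2) (-1) _ _
      (weight_mul_norm_lin_le hw 1 1 _ _ h2 h0) h1
    rw [← hs] at this
    norm_num at this
    linarith
  have a2 : w * ‖q‖ ≤ (4 * α + 6) * E := by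
    have := weight_mul_norm_lin_le hw 1 (-(2 * (α + 1) : ℝ) : ℂ) _ _
      (weight_mul_norm_lin_le hw 1 (-1) _ _ h1 h0) a1
    rw [← hq, norm_neg (((2 * (α + 1) : ℝ)) : ℂ), Complex.norm_real,
      Real.norm_of_nonneg (by positivity)] at this
    simp only [norm_one, norm_neg] at this
    linarith
  refine ⟨a1, a2, ?_⟩
  have := weight_mul_norm_lin_le hw 1 (-(α * (α + 1) : ℝ) : ℂ) _ _
    (weight_mul_norm_lin_le hw 1 (-(α : ℝ) : ℂ) _ _ h0 a2) a1
  rw [← hp, norm_neg ((α * (α + 1) : ℝ) : ℂ), norm_neg (α : ℂ), Complex.norm_real, Complex.norm_real,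
    Real.norm_of_nonneg (by positivity), Real.norm_of_nonneg (by positivity)] at this
  simp only [norm_one] at this
  linarith

lemma le_mul_rpow_of_mul_rpow_le {w x t y e e' c C N E : ℝ} (hw : 0 ≤ w) (hx : 0 ≤ x)
    (hy : 0 < y) (he : e' = -e) (ht : 1 / 4 ≤ t) (h : w * (x * t * y ^ e) ≤ c * (N * E))
    (hE : 0 ≤ N * E) (hc : 4 * c ≤ C) : w * x ≤ C * N * E * y ^ e' := by
  have h1 : y ^ e * y ^ e' = 1 := by rw [← Real.rpow_add hy, he]; simp
  calc w * x = 4 * (w * (x * (1 / 4) * y ^ e)) * y ^ e' := by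
        rw [show 4 * (w * (x * (1 / 4) * y ^ e)) * y ^ e' = w * x * (y ^ e * y ^ e') by ring, h1,
          mul_one]
    _ ≤ 4 * (w * (x * t * y ^ e)) * y ^ e' := by gcongr
    _ ≤ 4 * (c * (N * E)) * y ^ e' := by gcongr
    _ = (4 * c) * (N * E) * y ^ e' := by ring
    _ ≤ C * (N * E) * y ^ e' := by gcongr
    _ = _ := by ring

/-- Each coefficient of `(u · f ∘ φ)''` is controlled near the boundary by the distance
from `uC_φ` to a compact operator. -/
lemma exists_coeff_le_of_compact {α : ℝ} (hα : 0 < α) : ∃ C : ℝ, 0 < C ∧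
    ∀ (β : ℝ) (u φ : ℂ → ℂ), DifferentiableOn ℂ u unitDisk → DifferentiableOn ℂ φ unitDisk →
      Set.MapsTo φ unitDisk unitDisk → BoundedBlochToZygmund α β u φ →
      ∀ K, IsCompactOpToZygmund α β (MemBloch α) K → ∀ L : ℝ,
      (∀ f, MemBloch α f → blochNorm α f ≤ 1 →
        zygNorm β (fun z => wcomp u φ f z - K f z) ≤ L) → ∀ δ : ℝ, 0 < δ →
      ∃ s : ℝ, 0 ≤ s ∧ s < 1 ∧ ∀ z ∈ unitDisk, s < ‖φ z‖ →
        (1 - ‖z‖ ^ 2) ^ β * ‖deriv (deriv u) z‖ ≤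
          C * (L + δ) * (1 - ‖φ z‖ ^ 2) ^ (α - 1) ∧
        (1 - ‖z‖ ^ 2) ^ β * ‖2 * deriv u z * deriv φ z + u z * deriv (deriv φ) z‖ ≤
          C * (L + δ) * (1 - ‖φ z‖ ^ 2) ^ α ∧
        (1 - ‖z‖ ^ 2) ^ β * ‖u z * deriv φ z ^ 2‖ ≤
          C * (L + δ) * (1 - ‖φ z‖ ^ 2) ^ (α + 1) := by
  set N : ℝ := 1 + (α + 2) * 2 ^ (α + 3) with hN
  have hNpos : 0 < N := by positivity
  set B : ℝ := 8 + 4 * (4 * α + 6) + 4 * (1 + α * (4 * α + 6) + 2 * (α * (α + 1))) with hB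
  refine ⟨B * N, by positivity, fun β u φ hu hφ hm hb K hK L hL δ hδ => ?_⟩
  have hi : ∀ i : ℕ, i < 3 → N⁻¹ * (1 + (α + i) * 2 ^ (α + i + 1)) ≤ 1 := by
    intro i hi
    have hi' : (i : ℝ) ≤ 2 := by exact_mod_cast (by omega : i ≤ 2)
    rw [inv_mul_le_iff₀ hNpos, mul_one, hN]
    have h2 : (2 : ℝ) ^ (α + i + 1) ≤ 2 ^ (α + 3) :=
      Real.rpow_le_rpow_of_exponent_le one_le_two (by linarith)
    gcongr
  choose! s hs1 hs using fun (i : ℕ) (hi3 : i < 3) => exists_weight_test_le (a := α + i) (inv_pos.2 hNpos) hα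
    (by simp) (hi i hi3) hu hφ hm hb hK hL hδ
  refine ⟨max (max (1 / 2) (s 0)) (max (s 1) (s 2)), by positivity, ?_, ?_⟩
  · exact max_lt (max_lt (by norm_num) (hs1 0 (by norm_num)))
      (max_lt (hs1 1 (by norm_num)) (hs1 2 (by norm_num)))
  intro z hz hsz
  simp only [max_lt_iff] at hsz
  obtain ⟨⟨hhalf, hz0⟩, hz1, hz2⟩ := hsz
  have hw : 0 ≤ (1 - ‖z‖ ^ 2) ^ β := Real.rpow_nonneg (one_sub_norm_sq_pos hz).le _
  have hy := one_sub_norm_sq_pos (hm hz)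
  have hlt : ∀ i : ℕ, i < 3 → s i < ‖φ z‖ := by
    intro i hi; interval_cases i <;> assumption
  set D := deriv (deriv u) z
  set X := 2 * deriv u z * deriv φ z + u z * deriv (deriv φ) z
  set Y := u z * deriv φ z ^ 2
  set y := 1 - ‖φ z‖ ^ 2
  obtain ⟨k1, k2, k3⟩ := weight_norm_le_of_three (E := N * (L + δ)) hw hα.le
      (p := D * ((y ^ (1 - α) : ℝ) : ℂ))
      (q := X * (starRingEnd ℂ) (φ z) * ((y ^ (-α) : ℝ) : ℂ))
      (s := Y * (starRingEnd ℂ) (φ z) ^ 2 * ((y ^ (-α - 1) : ℝ) : ℂ)) fun i hi => by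
    have := hs i hi z hz (hlt i hi)
    rwa [inv_inv] at this
  simp only [norm_mul, norm_pow, RCLike.norm_conj, Complex.norm_real] at k1 k2 k3
  rw [Real.norm_of_nonneg (by positivity)] at k1 k2 k3
  have hE : 0 ≤ N * (L + δ) := by
    have : 0 ≤ 2 * (N * (L + δ)) := le_trans (by positivity) k1
    linarith
  have hsq : 1 / 4 ≤ ‖φ z‖ ^ 2 := by nlinarith
  refine ⟨?_, ?_, ?_⟩
  · refine le_mul_rpow_of_mul_rpow_le (t := 1) (e := 1 - α) hw (norm_nonneg _) hy (by ring)
      (by norm_num) (by simpa using k3) hE ?_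
    rw [hB]; nlinarith
  · refine le_mul_rpow_of_mul_rpow_le (e := -α) hw (norm_nonneg _) hy (by ring)
      (by linarith) k2 hE ?_
    rw [hB]; nlinarith
  · refine le_mul_rpow_of_mul_rpow_le (e := -α - 1) hw (norm_nonneg _) hy (by ring)
      hsq k1 hE ?_
    rw [hB]; nlinarith


/-! ### Growth of Bloch functions -/

/-- Cauchy's estimate: differentiation raises the growth exponent by one. -/
lemma norm_deriv_le_of_norm_le_rpow {c γ : ℝ} (hc : 0 ≤ c) (hγ : 0 ≤ γ) {g : ℂ → ℂ}
    (hg : DifferentiableOn ℂ g unitDisk)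
    (h : ∀ z ∈ unitDisk, ‖g z‖ ≤ c * (1 - ‖z‖ ^ 2) ^ (-γ)) {z : ℂ} (hz : z ∈ unitDisk) :
    ‖deriv g z‖ ≤ c * 4 ^ (γ + 1) * (1 - ‖z‖ ^ 2) ^ (-(γ + 1)) := by
  have hz1 := mem_unitDisk.1 hz
  have hy := one_sub_norm_sq_pos hz
  have hn := norm_nonneg z
  have hR : 0 < (1 - ‖z‖) / 2 := by linarith
  have hsub : ∀ w ∈ Metric.closedBall z ((1 - ‖z‖) / 2), ‖w‖ ≤ (1 + ‖z‖) / 2 := by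
    intro w hw
    have h1 : ‖w - z‖ ≤ (1 - ‖z‖) / 2 := by simpa [dist_eq_norm] using hw
    have h2 : ‖w‖ ≤ ‖w - z‖ + ‖z‖ := by simpa using norm_add_le (w - z) z
    linarith
  have hsubD : Metric.closedBall z ((1 - ‖z‖) / 2) ⊆ unitDisk := fun w hw =>
    mem_unitDisk.2 (by linarith [hsub w hw])
  have hd : DiffContOnCl ℂ g (Metric.ball z ((1 - ‖z‖) / 2)) := by
    refine DifferentiableOn.diffContOnCl ?_
    rw [closure_ball z hR.ne']
    exact hg.mono hsubD
  have hy4 : 0 < (1 - ‖z‖ ^ 2) / 4 := by linarith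
  have hs : ∀ w ∈ Metric.sphere z ((1 - ‖z‖) / 2), ‖g w‖ ≤ c * ((1 - ‖z‖ ^ 2) / 4) ^ (-γ) := by
    intro w hw
    have hw' := Metric.sphere_subset_closedBall hw
    have h1 := hsub w hw'
    refine (h w (hsubD hw')).trans (mul_le_mul_of_nonneg_left ?_ hc)
    refine Real.rpow_le_rpow_of_nonpos hy4 ?_ (by linarith)
    nlinarith [norm_nonneg w]
  calc ‖deriv g z‖ ≤ c * ((1 - ‖z‖ ^ 2) / 4) ^ (-γ) / ((1 - ‖z‖) / 2) :=
        Complex.norm_deriv_le_of_forall_mem_sphere_norm_le hR hd hs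
    _ ≤ c * ((1 - ‖z‖ ^ 2) / 4) ^ (-γ) / ((1 - ‖z‖ ^ 2) / 4) := by
        refine div_le_div_of_nonneg_left (by positivity) hy4 ?_
        nlinarith
    _ = c * ((1 - ‖z‖ ^ 2) / 4) ^ (-(γ + 1)) := by
        rw [neg_add, ← sub_eq_add_neg, Real.rpow_sub hy4, Real.rpow_one, mul_div_assoc]
    _ = _ := by
        rw [Real.div_rpow hy.le (by norm_num), Real.rpow_neg (by norm_num : (0:ℝ) ≤ 4),
          div_inv_eq_mul]
        ring

lemma norm_deriv_le_of_blochNorm_le {α : ℝ} {f : ℂ → ℂ} (hf : MemBloch α f)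
    (h1 : blochNorm α f ≤ 1) {z : ℂ} (hz : z ∈ unitDisk) :
    ‖deriv f z‖ ≤ (1 - ‖z‖ ^ 2) ^ (-α) := by
  have hy := one_sub_norm_sq_pos hz
  have h2 := le_wnorm hf.2 hz
  have h3 : wnorm α (deriv f) ≤ 1 := by
    unfold blochNorm at h1; linarith [norm_nonneg (f 0)]
  rw [Real.rpow_neg hy.le, ← one_div, le_div_iff₀' (by positivity)]
  exact h2.trans h3

lemma norm_le_of_blochNorm_le {α : ℝ} (hα : 1 < α) {f : ℂ → ℂ} (hf : MemBloch α f)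
    (h1 : blochNorm α f ≤ 1) {z : ℂ} (hz : z ∈ unitDisk) :
    ‖f z‖ ≤ (1 + 2 ^ (α - 1) / (α - 1)) * (1 - ‖z‖ ^ 2) ^ (-(α - 1)) := by
  have hz1 := mem_unitDisk.1 hz
  have hn := norm_nonneg z
  have hy := one_sub_norm_sq_pos hz
  have hα1 : 0 < α - 1 := by linarith
  have htz : ∀ t ∈ Icc (0 : ℝ) 1, t * ‖z‖ < 1 := fun t ht => by nlinarith [ht.1, ht.2]
  have hmem : ∀ t ∈ Icc (0 : ℝ) 1, (t : ℂ) * z ∈ unitDisk := fun t ht => by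
    rw [mem_unitDisk, norm_mul, Complex.norm_real, Real.norm_of_nonneg ht.1]; exact htz t ht
  have hF : ∀ t ∈ Icc (0 : ℝ) 1,
      HasDerivAt (fun t : ℝ => f (t * z)) (deriv f (t * z) * z) t := by
    intro t ht
    have h2 := (hf.1.differentiableAt (unitDisk_mem_nhds (hmem t ht))).hasDerivAt
    have h3 : HasDerivAt (fun t : ℝ => (t : ℂ) * z) z t := by
      simpa using (Complex.ofRealCLM.hasDerivAt (x := t)).mul_const z
    exact h2.comp t h3
  have hB : ∀ t ∈ Icc (0 : ℝ) 1,
      HasDerivAt (fun t : ℝ => 1 + (1 - t * ‖z‖) ^ (1 - α) / (α - 1))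
        (‖z‖ * (1 - t * ‖z‖) ^ (-α)) t := by
    intro t ht
    have h2 : HasDerivAt (fun t : ℝ => 1 - t * ‖z‖) (-‖z‖) t := by
      simpa using ((hasDerivAt_id t).mul_const ‖z‖).const_sub 1
    have h3 := ((h2.rpow_const (p := 1 - α) (Or.inl (by linarith [htz t ht]))).div_const
      (α - 1)).const_add 1
    refine h3.congr_deriv ?_
    rw [show 1 - α - 1 = -α by ring]
    field_simp
    ring
  have hf0 : ‖f 0‖ ≤ 1 := by
    unfold blochNorm at h1; linarith [wnorm_nonneg α (deriv f)]
  have key := image_norm_le_of_norm_deriv_right_le_deriv_boundary'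
    (f := fun t : ℝ => f (t * z)) (f' := fun t : ℝ => deriv f (t * z) * z) (a := 0) (b := 1)
    (B := fun t : ℝ => 1 + (1 - t * ‖z‖) ^ (1 - α) / (α - 1))
    (B' := fun t : ℝ => ‖z‖ * (1 - t * ‖z‖) ^ (-α))
    (fun t ht => (hF t ht).continuousAt.continuousWithinAt)
    (fun t ht => (hF t ⟨ht.1, ht.2.le⟩).hasDerivWithinAt)
    (by simp only [Complex.ofReal_zero, zero_mul, sub_zero, Real.one_rpow]
        have : 0 < 1 / (α - 1) := by positivity
        linarith)
    (fun t ht => (hB t ht).continuousAt.continuousWithinAt)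
    (fun t ht => (hB t ⟨ht.1, ht.2.le⟩).hasDerivWithinAt)
    (fun t ht => by
      have ht' : t ∈ Icc (0 : ℝ) 1 := ⟨ht.1, ht.2.le⟩
      have h2 := norm_deriv_le_of_blochNorm_le hf h1 (hmem t ht')
      rw [norm_mul, mul_comm]
      refine mul_le_mul_of_nonneg_left (h2.trans ?_) hn
      have h3 := htz t ht'
      refine Real.rpow_le_rpow_of_nonpos (by linarith) ?_ (by linarith)
      rw [norm_mul, Complex.norm_real, Real.norm_of_nonneg ht.1]
      nlinarith [mul_nonneg ht.1 hn])
    (x := 1) ⟨zero_le_one, le_rfl⟩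
  simp only [Complex.ofReal_one, one_mul] at key
  have e1 : 1 ≤ (1 - ‖z‖ ^ 2) ^ (-(α - 1)) :=
    Real.one_le_rpow_of_pos_of_le_one_of_nonpos hy (one_sub_norm_sq_le_one z) (by linarith)
  have e2 : (1 - ‖z‖) ^ (1 - α) ≤ 2 ^ (α - 1) * (1 - ‖z‖ ^ 2) ^ (-(α - 1)) := by
    calc (1 - ‖z‖) ^ (1 - α) ≤ ((1 - ‖z‖ ^ 2) / 2) ^ (1 - α) :=
          Real.rpow_le_rpow_of_nonpos (by linarith) (by nlinarith) (by linarith)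
      _ = _ := by
          rw [Real.div_rpow hy.le (by norm_num), ← neg_sub α 1,
            Real.rpow_neg (by norm_num : (0:ℝ) ≤ 2), div_inv_eq_mul, mul_comm]
  calc ‖f z‖ ≤ 1 + (1 - ‖z‖) ^ (1 - α) / (α - 1) := key
    _ ≤ (1 - ‖z‖ ^ 2) ^ (-(α - 1)) +
        2 ^ (α - 1) * (1 - ‖z‖ ^ 2) ^ (-(α - 1)) / (α - 1) := by gcongr
    _ = _ := by ring

lemma exists_bloch_growth {α : ℝ} (hα : 1 < α) : ∃ C : ℝ, 0 < C ∧
    ∀ f, MemBloch α f → blochNorm α f ≤ 1 → ∀ z ∈ unitDisk,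
      ‖f z‖ ≤ C * (1 - ‖z‖ ^ 2) ^ (-(α - 1)) ∧
      ‖deriv f z‖ ≤ C * (1 - ‖z‖ ^ 2) ^ (-α) ∧
      ‖deriv (deriv f) z‖ ≤ C * (1 - ‖z‖ ^ 2) ^ (-(α + 1)) ∧
      ‖deriv (deriv (deriv f)) z‖ ≤ C * (1 - ‖z‖ ^ 2) ^ (-(α + 1 + 1)) := by
  have hα1 : 0 < α - 1 := by linarith
  have hp : (0 : ℝ) < 2 ^ (α - 1) / (α - 1) := by positivity
  have hq : (1 : ℝ) ≤ 4 ^ (α + 1) := Real.one_le_rpow (by norm_num) (by linarith)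
  have hq' : (1 : ℝ) ≤ 4 ^ (α + 1 + 1) := Real.one_le_rpow (by norm_num) (by linarith)
  refine ⟨1 + 2 ^ (α - 1) / (α - 1) + 4 ^ (α + 1) + 4 ^ (α + 1) * 4 ^ (α + 1 + 1),
    by positivity, fun f hf h1 z hz => ?_⟩
  have hd : ∀ z ∈ unitDisk, ‖deriv f z‖ ≤ 1 * (1 - ‖z‖ ^ 2) ^ (-α) := fun z hz => by
    simpa using norm_deriv_le_of_blochNorm_le hf h1 hz
  have hf1 := hf.1.deriv isOpen_unitDisk
  have hd2 : ∀ z ∈ unitDisk,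
      ‖deriv (deriv f) z‖ ≤ 1 * 4 ^ (α + 1) * (1 - ‖z‖ ^ 2) ^ (-(α + 1)) :=
    fun z hz => norm_deriv_le_of_norm_le_rpow zero_le_one (by linarith) hf1 hd hz
  have hd3 := norm_deriv_le_of_norm_le_rpow (by positivity) (by linarith)
    (hf1.deriv isOpen_unitDisk) hd2 hz
  have hy := one_sub_norm_sq_pos hz
  refine ⟨(norm_le_of_blochNorm_le hα hf h1 hz).trans ?_, (hd z hz).trans ?_,
    (hd2 z hz).trans ?_, hd3.trans ?_⟩ <;>
  refine mul_le_mul_of_nonneg_right ?_ (Real.rpow_nonneg hy.le _) <;> nlinarith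

/-! ### Approximation by dilations -/

lemma norm_sub_mul_dilate_le {C γ r ρ : ℝ} (hC : 0 ≤ C) (hγ : 0 ≤ γ) (hr : 0 ≤ r) (hr1 : r ≤ 1)
    (hρ : 0 ≤ ρ) (hρ1 : ρ ≤ 1) {g : ℂ → ℂ}
    (h : ∀ z ∈ unitDisk, ‖g z‖ ≤ C * (1 - ‖z‖ ^ 2) ^ (-γ)) {w : ℂ} (hw : w ∈ unitDisk) :
    ‖g w - ρ * g (r * w)‖ ≤ 2 * C * (1 - ‖w‖ ^ 2) ^ (-γ) := by
  have hy := one_sub_norm_sq_pos hw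
  have hrw : ‖(r : ℂ) * w‖ ≤ ‖w‖ := by
    rw [norm_mul, Complex.norm_real, Real.norm_of_nonneg hr]
    exact mul_le_of_le_one_left (norm_nonneg _) hr1
  have hrwD : (r : ℂ) * w ∈ unitDisk := mem_unitDisk.2 (hrw.trans_lt (mem_unitDisk.1 hw))
  have h1 : ‖g (r * w)‖ ≤ C * (1 - ‖w‖ ^ 2) ^ (-γ) := by
    refine (h _ hrwD).trans (mul_le_mul_of_nonneg_left ?_ hC)
    refine Real.rpow_le_rpow_of_nonpos hy ?_ (by linarith)
    nlinarith [norm_nonneg ((r : ℂ) * w), norm_nonneg w]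
  have h2 : ‖(ρ : ℂ) * g (r * w)‖ ≤ ‖g (r * w)‖ := by
    rw [norm_mul, Complex.norm_real, Real.norm_of_nonneg hρ]
    exact mul_le_of_le_one_left (norm_nonneg _) hρ1
  have := norm_sub_le (g w) (ρ * g (r * w))
  linarith [h w hw]

lemma norm_sub_mul_dilate_le_of_norm_le {C γ r ρ s : ℝ} (hC : 0 ≤ C) (hγ : 0 ≤ γ) (hr : 0 ≤ r)
    (hr1 : r ≤ 1) (hρ1 : ρ ≤ 1) (hρr : 1 - ρ ≤ 2 * (1 - r)) (hs1 : s < 1)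
    {g : ℂ → ℂ} (hg : DifferentiableOn ℂ g unitDisk)
    (h : ∀ z ∈ unitDisk, ‖g z‖ ≤ C * (1 - ‖z‖ ^ 2) ^ (-γ))
    (h' : ∀ z ∈ unitDisk, ‖deriv g z‖ ≤ C * (1 - ‖z‖ ^ 2) ^ (-(γ + 1)))
    {w : ℂ} (hw : ‖w‖ ≤ s) :
    ‖g w - ρ * g (r * w)‖ ≤ (1 - r) * (3 * C * (1 - s ^ 2) ^ (-(γ + 1))) := by
  have hs : 0 ≤ s := (norm_nonneg w).trans hw
  have hS : 0 < 1 - s ^ 2 := by nlinarith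
  have hrw : ‖(r : ℂ) * w‖ ≤ s := by
    rw [norm_mul, Complex.norm_real, Real.norm_of_nonneg hr]
    exact (mul_le_of_le_one_left (norm_nonneg _) hr1).trans hw
  have hD : ∀ z ∈ Metric.closedBall (0 : ℂ) s, z ∈ unitDisk ∧ 1 - s ^ 2 ≤ 1 - ‖z‖ ^ 2 := by
    intro z hz
    have hz' : ‖z‖ ≤ s := by simpa using hz
    exact ⟨mem_unitDisk.2 (by linarith), by nlinarith [norm_nonneg z]⟩
  have hrwm : (r : ℂ) * w ∈ Metric.closedBall (0 : ℂ) s := by simpa using hrw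
  have hwm : w ∈ Metric.closedBall (0 : ℂ) s := by simpa using hw
  have e1 : ‖g w - g (r * w)‖ ≤ C * (1 - s ^ 2) ^ (-(γ + 1)) * ‖w - r * w‖ := by
    refine (convex_closedBall (0 : ℂ) s).norm_image_sub_le_of_norm_deriv_le
      (fun z hz => hg.differentiableAt (unitDisk_mem_nhds (hD z hz).1)) (fun z hz => ?_) hrwm hwm
    refine (h' z (hD z hz).1).trans (mul_le_mul_of_nonneg_left ?_ hC)
    exact Real.rpow_le_rpow_of_nonpos hS (hD z hz).2 (by linarith)
  have e2 : ‖w - r * w‖ ≤ 1 - r := by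
    rw [show w - r * w = ((1 - r : ℝ) : ℂ) * w by push_cast; ring, norm_mul, Complex.norm_real,
      Real.norm_of_nonneg (by linarith)]
    exact mul_le_of_le_one_right (by linarith) (by linarith)
  have e3 : ‖g (r * w)‖ ≤ C * (1 - s ^ 2) ^ (-(γ + 1)) := by
    refine (h _ (hD _ hrwm).1).trans (mul_le_mul_of_nonneg_left ?_ hC)
    refine (Real.rpow_le_rpow_of_nonpos hS (hD _ hrwm).2 (by linarith)).trans ?_
    exact Real.rpow_le_rpow_of_exponent_ge hS (by nlinarith) (by linarith)
  have e4 : ‖((1 - ρ : ℝ) : ℂ) * g (r * w)‖ ≤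
      (2 * (1 - r)) * (C * (1 - s ^ 2) ^ (-(γ + 1))) := by
    rw [norm_mul, Complex.norm_real, Real.norm_of_nonneg (by linarith)]
    exact mul_le_mul hρr e3 (norm_nonneg _) (by linarith)
  have e5 : C * (1 - s ^ 2) ^ (-(γ + 1)) * ‖w - r * w‖ ≤
      C * (1 - s ^ 2) ^ (-(γ + 1)) * (1 - r) := mul_le_mul_of_nonneg_left e2 (by positivity)
  calc ‖g w - ρ * g (r * w)‖
      = ‖(g w - g (r * w)) + ((1 - ρ : ℝ) : ℂ) * g (r * w)‖ := by
        congr 1; push_cast; ring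
    _ ≤ _ := norm_add_le _ _
    _ ≤ _ := by linarith

lemma memBloch_dilate {α : ℝ} (hα : 0 ≤ α) {r : ℝ} (hr : 0 ≤ r) (hr1 : r < 1) {f : ℂ → ℂ}
    (hf : DifferentiableOn ℂ f unitDisk) : MemBloch α (fun z => f (r * z)) := by
  have hm : ∀ z : ℂ, ‖z‖ ≤ 1 → ‖(r : ℂ) * z‖ ≤ r := fun z hz => by
    rw [norm_mul, Complex.norm_real, Real.norm_of_nonneg hr]
    exact mul_le_of_le_one_right hr hz
  have hsub : Metric.closedBall (0 : ℂ) r ⊆ unitDisk := fun z hz => by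
    have : ‖z‖ ≤ r := by simpa using hz
    exact mem_unitDisk.2 (by linarith)
  obtain ⟨c, hc⟩ := (isCompact_closedBall (0 : ℂ) r).exists_bound_of_continuousOn
    ((hf.deriv isOpen_unitDisk).continuousOn.mono hsub)
  refine (memBloch_of_deriv_le (c := c) hα ?_ fun z hz => ?_).1
  · refine hf.comp (by fun_prop) fun z hz => ?_
    exact mem_unitDisk.2 ((hm z (mem_unitDisk.1 hz).le).trans_lt hr1)
  · have h1 := hc (r * z) (by simpa using hm z (mem_unitDisk.1 hz).le)
    rw [deriv_comp_mul_left, smul_eq_mul, norm_mul, Complex.norm_real, Real.norm_of_nonneg hr]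
    exact (mul_le_of_le_one_left (norm_nonneg _) hr1.le).trans h1

lemma mul_norm_mul_le_of_rpow {w y E C e : ℝ} (hy : 0 < y) {a b : ℂ}
    (hE : 0 ≤ E) (ha : w * ‖a‖ ≤ E * y ^ e) (hb : ‖b‖ ≤ C * y ^ (-e)) :
    w * ‖a * b‖ ≤ C * E := by
  rw [norm_mul, ← mul_assoc]
  calc w * ‖a‖ * ‖b‖ ≤ E * y ^ e * (C * y ^ (-e)) :=
        mul_le_mul ha hb (norm_nonneg _) (by positivity)
    _ = C * E * (y ^ e * y ^ (-e)) := by ring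
    _ = C * E := by rw [← Real.rpow_add hy, add_neg_cancel, Real.rpow_zero, mul_one]

lemma exists_zygNorm_sub_dilate_le {α : ℝ} (hα : 1 < α) : ∃ C : ℝ, 0 < C ∧
    ∀ (β : ℝ) (u φ : ℂ → ℂ), DifferentiableOn ℂ u unitDisk → DifferentiableOn ℂ φ unitDisk →
      Set.MapsTo φ unitDisk unitDisk → BoundedBlochToZygmund α β u φ →
      ∀ E s : ℝ, 0 ≤ E → s < 1 →
      (∀ z ∈ unitDisk, s < ‖φ z‖ →
        (1 - ‖z‖ ^ 2) ^ β * ‖deriv (deriv u) z‖ ≤ E * (1 - ‖φ z‖ ^ 2) ^ (α - 1) ∧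
        (1 - ‖z‖ ^ 2) ^ β * ‖2 * deriv u z * deriv φ z + u z * deriv (deriv φ) z‖ ≤
          E * (1 - ‖φ z‖ ^ 2) ^ α ∧
        (1 - ‖z‖ ^ 2) ^ β * ‖u z * deriv φ z ^ 2‖ ≤ E * (1 - ‖φ z‖ ^ 2) ^ (α + 1)) →
      ∀ ε : ℝ, 0 < ε → ∃ r₀ : ℝ, 0 ≤ r₀ ∧ r₀ < 1 ∧ ∀ r : ℝ, r₀ < r → r < 1 →
        ∀ f, MemBloch α f → blochNorm α f ≤ 1 →
          zygNorm β (wcomp u φ (fun z => f z - f (r * z))) ≤ C * E + ε := by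
  obtain ⟨C, hC, hgrow⟩ := exists_bloch_growth hα
  refine ⟨6 * C, by positivity, fun β u φ hu hφ hm hb E s hE hs1 hcoef ε hε => ?_⟩
  obtain ⟨c, hc⟩ := coeff_bounds (by linarith : (0:ℝ) ≤ α) hu hφ hm hb
  have hc0 : 0 ≤ c := by
    refine le_trans ?_ (hc 0 zero_mem_unitDisk).1
    simp
  obtain ⟨S, hS⟩ : ∃ S, S = max s ‖φ 0‖ := ⟨_, rfl⟩
  have hφ0 := mem_unitDisk.1 (hm zero_mem_unitDisk)
  have hS1 : S < 1 := hS ▸ max_lt hs1 hφ0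
  have hsS : s ≤ S := hS ▸ le_max_left _ _
  have hφS : ‖φ 0‖ ≤ S := hS ▸ le_max_right _ _
  have hS0 : 0 ≤ S := (norm_nonneg _).trans hφS
  have hSy : 0 < 1 - S ^ 2 := by nlinarith
  obtain ⟨K, hK⟩ : ∃ K, K = 3 * C * (1 - S ^ 2) ^ (-(α + 1 + 1)) := ⟨_, rfl⟩
  have hK0 : 0 < K := by rw [hK]; positivity
  obtain ⟨A, hA⟩ : ∃ A, A = ‖u 0‖ + (‖deriv u 0‖ + ‖u 0‖ * ‖deriv φ 0‖) + 3 * c := ⟨_, rfl⟩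
  have hA0 : 0 ≤ A := by rw [hA]; positivity
  refine ⟨max 0 (1 - ε / (K * A + 1)), le_max_left _ _, max_lt one_pos ?_, ?_⟩
  · have : 0 < ε / (K * A + 1) := by positivity
    linarith
  intro r hr hr1 f hf hf1
  have hr0 : 0 ≤ r := ((le_max_left _ _).trans_lt hr).le
  have hrε : (1 - r) * K * A ≤ ε := by
    have h1 : 1 - r ≤ ε / (K * A + 1) := by linarith [(le_max_right _ _).trans_lt hr]
    rw [le_div_iff₀ (by positivity)] at h1
    nlinarith
  have hfr := memBloch_dilate (α := α) (by linarith) hr0 hr1 hf.1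
  have hh : MemBloch α (fun z => f z - f (r * z)) := hf.sub hfr
  have hfd := hf.1.deriv isOpen_unitDisk
  have hfdd := hfd.deriv isOpen_unitDisk
  obtain ⟨h, hh_def⟩ : ∃ h : ℂ → ℂ, h = fun z => f z - f (r * z) := ⟨_, rfl⟩
  rw [← hh_def] at hh ⊢
  have d1 : ∀ w ∈ unitDisk, deriv h w = deriv f w - r * deriv f (r * w) := by
    intro w hw
    rw [hh_def, deriv_fun_sub (hf.1.differentiableAt (unitDisk_mem_nhds hw))
      (hfr.1.differentiableAt (unitDisk_mem_nhds hw)), deriv_comp_mul_left, smul_eq_mul]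
  have d2 : ∀ w ∈ unitDisk,
      deriv (deriv h) w = deriv (deriv f) w - (r ^ 2 : ℝ) * deriv (deriv f) (r * w) := by
    intro w hw
    have e : deriv h =ᶠ[nhds w] fun w => deriv f w - r * deriv f (r * w) := by
      filter_upwards [unitDisk_mem_nhds hw] with y hy using d1 y hy
    have hfr' := (memBloch_dilate (α := α) (by linarith) hr0 hr1 hfd).1.differentiableAt
      (unitDisk_mem_nhds hw)
    rw [e.deriv_eq, deriv_fun_sub (hfd.differentiableAt (unitDisk_mem_nhds hw))
      (hfr'.const_mul _), deriv_const_mul_field, deriv_comp_mul_left, smul_eq_mul]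
    push_cast; ring
  have d0 : ∀ w, h w = f w - (1 : ℝ) * f (r * w) := fun w => by rw [hh_def]; simp
  have hr2 : r ^ 2 ≤ 1 := by nlinarith
  have mono : ∀ γ : ℝ, γ ≤ α + 1 →
      (1 - r) * (3 * C * (1 - S ^ 2) ^ (-(γ + 1))) ≤ (1 - r) * K := by
    intro γ hγ
    rw [hK]
    refine mul_le_mul_of_nonneg_left (mul_le_mul_of_nonneg_left ?_ (by positivity)) (by linarith)
    exact Real.rpow_le_rpow_of_exponent_ge hSy (by nlinarith) (by linarith)
  have g0 := fun z hz => (hgrow f hf hf1 z hz).1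
  have g1 := fun z hz => (hgrow f hf hf1 z hz).2.1
  have g2 := fun z hz => (hgrow f hf hf1 z hz).2.2.1
  have g3 := fun z hz => (hgrow f hf hf1 z hz).2.2.2
  have small : ∀ w, ‖w‖ ≤ S → ‖h w‖ ≤ (1 - r) * K ∧ ‖deriv h w‖ ≤ (1 - r) * K ∧
      ‖deriv (deriv h) w‖ ≤ (1 - r) * K := by
    intro w hw
    have hwD : w ∈ unitDisk := mem_unitDisk.2 (by linarith)
    rw [d0, d1 w hwD, d2 w hwD]
    refine ⟨?_, ?_, ?_⟩
    · exact (norm_sub_mul_dilate_le_of_norm_le hC.le (by linarith) hr0 hr1.le le_rfl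
        (by linarith) hS1 hf.1 g0 (by simpa using g1) hw).trans (mono _ (by linarith))
    · exact (norm_sub_mul_dilate_le_of_norm_le hC.le (by linarith) hr0 hr1.le hr1.le
        (by linarith) hS1 hfd g1 g2 hw).trans (mono _ (by linarith))
    · exact (norm_sub_mul_dilate_le_of_norm_le hC.le (by linarith) hr0 hr1.le hr2
        (by nlinarith) hS1 hfdd g2 g3 hw).trans (mono _ (by linarith))
  have large : ∀ w ∈ unitDisk, ‖h w‖ ≤ 2 * C * (1 - ‖w‖ ^ 2) ^ (-(α - 1)) ∧
      ‖deriv h w‖ ≤ 2 * C * (1 - ‖w‖ ^ 2) ^ (-α) ∧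
      ‖deriv (deriv h) w‖ ≤ 2 * C * (1 - ‖w‖ ^ 2) ^ (-(α + 1)) := by
    intro w hw
    rw [d0, d1 w hw, d2 w hw]
    exact ⟨norm_sub_mul_dilate_le hC.le (by linarith) hr0 hr1.le zero_le_one le_rfl g0 hw,
      norm_sub_mul_dilate_le hC.le (by linarith) hr0 hr1.le hr0 hr1.le g1 hw,
      norm_sub_mul_dilate_le hC.le (by linarith) hr0 hr1.le (by positivity) hr2 g2 hw⟩
  obtain ⟨κ, hκ⟩ : ∃ κ, κ = (1 - r) * K := ⟨_, rfl⟩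
  have hκ0 : 0 ≤ κ := by rw [hκ]; exact mul_nonneg (by linarith) hK0.le
  rw [← hκ] at small hrε
  have second : wnorm β (deriv (deriv (wcomp u φ h))) ≤ 6 * C * E + 3 * c * κ := by
    refine wnorm_le fun z hz => ?_
    have hw : 0 ≤ (1 - ‖z‖ ^ 2) ^ β := Real.rpow_nonneg (one_sub_norm_sq_pos hz).le _
    have hy := one_sub_norm_sq_pos (hm hz)
    rw [deriv_deriv_wcomp hu hφ hm hh.1 hz]
    have tri : ∀ a b d : ℂ, (1 - ‖z‖ ^ 2) ^ β * ‖a + b + d‖ ≤ (1 - ‖z‖ ^ 2) ^ β * ‖a‖ +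
        (1 - ‖z‖ ^ 2) ^ β * ‖b‖ + (1 - ‖z‖ ^ 2) ^ β * ‖d‖ := fun a b d => by
      rw [← mul_add, ← mul_add]
      exact mul_le_mul_of_nonneg_left norm_add₃_le hw
    refine (tri _ _ _).trans ?_
    by_cases hzS : ‖φ z‖ ≤ S
    · obtain ⟨s0, s1, s2⟩ := small _ hzS
      obtain ⟨c0, c1, c2⟩ := hc z hz
      have aux : ∀ a b : ℂ, (1 - ‖z‖ ^ 2) ^ β * ‖a‖ ≤ c → ‖b‖ ≤ κ →
          (1 - ‖z‖ ^ 2) ^ β * ‖a * b‖ ≤ c * κ := fun a b ha hb => by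
        rw [norm_mul, ← mul_assoc]
        exact mul_le_mul ha hb (norm_nonneg _) hc0
      have := aux _ _ c0 s0
      have := aux _ _ c1 s1
      have := aux _ _ c2 s2
      have : 0 ≤ C * E := by positivity
      linarith
    · obtain ⟨c0, c1, c2⟩ := hcoef z hz (by linarith)
      obtain ⟨l0, l1, l2⟩ := large _ (hm hz)
      have := mul_norm_mul_le_of_rpow hy hE c0 l0
      have := mul_norm_mul_le_of_rpow hy hE c1 l1
      have := mul_norm_mul_le_of_rpow hy hE c2 l2
      have : 0 ≤ c * κ := by positivity
      linarith
  obtain ⟨s0, s1, -⟩ := small _ hφS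
  have first : ‖wcomp u φ h 0‖ ≤ ‖u 0‖ * κ := by
    rw [wcomp, norm_mul]
    exact mul_le_mul_of_nonneg_left s0 (norm_nonneg _)
  have mid : ‖deriv (wcomp u φ h) 0‖ ≤ (‖deriv u 0‖ + ‖u 0‖ * ‖deriv φ 0‖) * κ := by
    rw [deriv_wcomp hu hφ hm hh.1 zero_mem_unitDisk]
    refine (norm_add_le _ _).trans ?_
    rw [norm_mul, norm_mul, norm_mul]
    have a1 := mul_le_mul_of_nonneg_left s0 (norm_nonneg (deriv u 0))
    have a2 := mul_le_mul_of_nonneg_left s1 (mul_nonneg (norm_nonneg (u 0))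
      (norm_nonneg (deriv φ 0)))
    linarith
  unfold zygNorm
  rw [hA] at hrε
  linarith

/-! ### Approximation by dilated Taylor polynomials -/

/-- The Taylor coefficients at the origin of the dilation `z ↦ f (r z)`. -/
def dilateCoeff (r : ℝ) (k : ℕ) (f : ℂ → ℂ) : ℂ :=
  ((k.factorial : ℂ)⁻¹ * iteratedDeriv k f 0) * r ^ k

lemma norm_taylor_coeff_le {t M : ℝ} (ht : 0 < t) (ht1 : t < 1) {f : ℂ → ℂ}
    (hf : DifferentiableOn ℂ f unitDisk) (hM : ∀ z ∈ Metric.sphere (0 : ℂ) t, ‖f z‖ ≤ M) (k : ℕ) :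
    ‖(k.factorial : ℂ)⁻¹ * iteratedDeriv k f 0‖ ≤ M / t ^ k := by
  have hsub : closure (Metric.ball (0 : ℂ) t) ⊆ unitDisk := by
    rw [closure_ball _ ht.ne']
    exact Metric.closedBall_subset_ball ht1
  have h := Complex.norm_iteratedDeriv_le_of_forall_mem_sphere_norm_le k ht
    (hf.mono hsub).diffContOnCl hM
  have hk : (0 : ℝ) < k.factorial := by exact_mod_cast k.factorial_pos
  rw [norm_mul, norm_inv, Complex.norm_natCast]
  calc (k.factorial : ℝ)⁻¹ * ‖iteratedDeriv k f 0‖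
      ≤ (k.factorial : ℝ)⁻¹ * (k.factorial * M / t ^ k) := by gcongr
    _ = M / t ^ k := by field_simp

lemma norm_dilate_sub_taylor_le {t M : ℝ} (ht : 0 < t) (ht1 : t < 1) {f : ℂ → ℂ}
    (hf : DifferentiableOn ℂ f unitDisk) (hM : ∀ z ∈ Metric.sphere (0 : ℂ) t, ‖f z‖ ≤ M) (N : ℕ)
    {z : ℂ} (hz : ‖z‖ < t⁻¹) :
    ‖f ((t ^ 3 : ℝ) * z) - ∑ k ∈ Finset.range N, dilateCoeff (t ^ 3) k f * z ^ k‖ ≤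
      M * t ^ N / (1 - t) := by
  have htz : t * ‖z‖ < 1 := by
    have := mul_lt_mul_of_pos_left hz ht
    rwa [mul_inv_cancel₀ ht.ne'] at this
  have hmem : ((t ^ 3 : ℝ) : ℂ) * z ∈ Metric.ball (0 : ℂ) 1 := by
    rw [mem_ball_zero_iff, norm_mul, Complex.norm_real, Real.norm_of_nonneg (by positivity)]
    nlinarith [mul_nonneg (sq_nonneg t) (sub_nonneg.2 htz.le)]
  have hsum : HasSum (fun k : ℕ => dilateCoeff (t ^ 3) k f * z ^ k) (f ((t ^ 3 : ℝ) * z)) := by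
    have e : (fun k : ℕ => dilateCoeff (t ^ 3) k f * z ^ k) = fun k : ℕ =>
        (k.factorial : ℂ)⁻¹ • (((t ^ 3 : ℝ) : ℂ) * z - 0) ^ k • iteratedDeriv k f 0 := by
      funext k
      simp only [dilateCoeff, smul_eq_mul, sub_zero, mul_pow]
      ring
    rw [e]
    exact Complex.hasSum_taylorSeries_on_ball hf hmem
  rw [norm_sub_rev]
  refine norm_sub_le_of_geometric_bound_of_hasSum ht1 (fun k => ?_) hsum N
  have hM0 : 0 ≤ M := (norm_nonneg _).trans (hM t (by simp [ht.le]))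
  rw [dilateCoeff, norm_mul, norm_mul, norm_pow, norm_pow, Complex.norm_real,
    Real.norm_of_nonneg (by positivity)]
  calc _ ≤ M / t ^ k * (t ^ 3) ^ k * (t⁻¹) ^ k := by
        gcongr
        exact norm_taylor_coeff_le ht ht1 hf hM k
    _ = M * t ^ k := by
        rw [← pow_mul, inv_pow]
        field_simp
        ring

/-- Dilations of the unit ball of `B^α` are uniformly approximated by Taylor polynomials. -/
lemma exists_dilate_taylor_approx {α : ℝ} (hα : 1 < α) {r₀ ε : ℝ} (hr₀ : 0 ≤ r₀) (hr₀1 : r₀ < 1)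
    (hε : 0 < ε) : ∃ r : ℝ, r₀ < r ∧ r < 1 ∧ ∃ N : ℕ, ∀ f, MemBloch α f → blochNorm α f ≤ 1 →
      blochNorm α (fun z => f (r * z) - ∑ k ∈ Finset.range N, dilateCoeff r k f * z ^ k) ≤ ε := by
  obtain ⟨C, hC, hgrow⟩ := exists_bloch_growth hα
  obtain ⟨t, ht⟩ : ∃ t, t = 1 - (1 - r₀) / 6 := ⟨_, rfl⟩
  have ht0 : 0 < t := by linarith
  have ht1 : t < 1 := by linarith
  have hr0t : r₀ < t ^ 3 := by
    rw [ht]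
    nlinarith [mul_nonneg (sub_nonneg.2 hr₀1.le) (sub_nonneg.2 hr₀1.le),
      mul_nonneg (mul_nonneg (sub_nonneg.2 hr₀1.le) (sub_nonneg.2 hr₀1.le)) hr₀]
  have ht31 : t ^ 3 < 1 := pow_lt_one₀ ht0.le ht1 (by norm_num)
  obtain ⟨M, hM⟩ : ∃ M, M = C * (1 - t ^ 2) ^ (-(α - 1)) := ⟨_, rfl⟩
  have hty : 0 < 1 - t ^ 2 := by nlinarith
  have hM0 : 0 < M := by rw [hM]; positivity
  have htinv : 1 < t⁻¹ := (one_lt_inv₀ ht0).2 ht1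
  obtain ⟨R, hR⟩ : ∃ R, R = (t⁻¹ - 1) / 2 := ⟨_, rfl⟩
  have hR0 : 0 < R := by rw [hR]; linarith
  obtain ⟨B, hB⟩ : ∃ B, B = M / (1 - t) + M / (1 - t) / R := ⟨_, rfl⟩
  have h1t : 0 < 1 - t := by linarith
  have hB0 : 0 < B := by rw [hB]; positivity
  obtain ⟨N, hN⟩ := exists_pow_lt_of_lt_one (div_pos hε hB0) ht1
  refine ⟨t ^ 3, hr0t, ht31, N, fun f hf hf1 => ?_⟩
  have hbd : ∀ z ∈ Metric.sphere (0 : ℂ) t, ‖f z‖ ≤ M := by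
    intro z hz
    have hz' : ‖z‖ = t := by simpa using hz
    have := (hgrow f hf hf1 z (mem_unitDisk.2 (by linarith))).1
    rwa [hz', ← hM] at this
  obtain ⟨g, hg⟩ : ∃ g : ℂ → ℂ, g = fun z => f ((t ^ 3 : ℝ) * z) -
      ∑ k ∈ Finset.range N, dilateCoeff (t ^ 3) k f * z ^ k := ⟨_, rfl⟩
  have hgle : ∀ z, ‖z‖ < t⁻¹ → ‖g z‖ ≤ M * t ^ N / (1 - t) := fun z hz => by
    rw [hg]; exact norm_dilate_sub_taylor_le ht0 ht1 hf.1 hbd N hz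
  have hgd : DifferentiableOn ℂ g (Metric.ball 0 t⁻¹) := by
    rw [hg]
    refine DifferentiableOn.sub (hf.1.comp (by fun_prop) fun z hz => ?_) (by fun_prop)
    have hz' : ‖z‖ < t⁻¹ := by simpa using hz
    have htz : t * ‖z‖ < 1 := by
      have := mul_lt_mul_of_pos_left hz' ht0
      rwa [mul_inv_cancel₀ ht0.ne'] at this
    rw [mem_unitDisk, norm_mul, Complex.norm_real, Real.norm_of_nonneg (by positivity)]
    nlinarith [mul_nonneg (sq_nonneg t) (sub_nonneg.2 htz.le)]
  have hder : ∀ z ∈ unitDisk, ‖deriv g z‖ ≤ M * t ^ N / (1 - t) / R := by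
    intro z hz
    have hz1 := mem_unitDisk.1 hz
    have hsub : Metric.closedBall z R ⊆ Metric.ball 0 t⁻¹ := by
      refine fun w hw => ?_
      have h1 : ‖w - z‖ ≤ R := by simpa [dist_eq_norm] using hw
      have h2 : ‖w‖ ≤ ‖w - z‖ + ‖z‖ := by simpa using norm_add_le (w - z) z
      rw [mem_ball_zero_iff]
      linarith
    refine Complex.norm_deriv_le_of_forall_mem_sphere_norm_le hR0
      (DifferentiableOn.diffContOnCl ?_) fun w hw => hgle w ?_
    · rw [closure_ball _ hR0.ne']
      exact hgd.mono hsub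
    · simpa using hsub (Metric.sphere_subset_closedBall hw)
  have hgD : DifferentiableOn ℂ g unitDisk := hgd.mono (Metric.ball_subset_ball htinv.le)
  have h0 := hgle 0 (by simpa using ht0)
  have hfin := (memBloch_of_deriv_le (α := α) (by linarith) hgD hder).2
  rw [← hg]
  calc blochNorm α g ≤ M * t ^ N / (1 - t) + M * t ^ N / (1 - t) / R := by linarith
    _ = t ^ N * B := by rw [hB]; ring
    _ ≤ ε / B * B := by gcongr
    _ = ε := by field_simp

/-! ### Finite rank operators -/

/-- The polynomial function with coefficients `c`. -/
def polyFn {N : ℕ} (c : Fin N → ℂ) (z : ℂ) : ℂ := ∑ k, c k * z ^ (k : ℕ)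

lemma memBloch_polyFn {α : ℝ} (hα : 0 ≤ α) {N : ℕ} (c : Fin N → ℂ) :
    MemBloch α (polyFn c) ∧ blochNorm α (polyFn c) ≤ ‖c‖ * ∑ k : Fin N, ((k : ℝ) + 1) := by
  have hd : DifferentiableOn ℂ (polyFn c) unitDisk := by unfold polyFn; fun_prop
  have hder : ∀ z ∈ unitDisk, ‖deriv (polyFn c) z‖ ≤ ‖c‖ * ∑ k : Fin N, (k : ℝ) := by
    intro z hz
    have h : HasDerivAt (polyFn c) (∑ k : Fin N, c k * ((k : ℕ) * z ^ ((k : ℕ) - 1))) z := by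
      unfold polyFn
      exact HasDerivAt.fun_sum fun k _ => (hasDerivAt_pow (k : ℕ) z).const_mul (c k)
    rw [h.deriv, Finset.mul_sum]
    refine norm_sum_le_of_le _ fun k _ => ?_
    rw [norm_mul, norm_mul, norm_pow, Complex.norm_natCast]
    refine mul_le_mul (norm_le_pi_norm c k) ?_ (by positivity) (norm_nonneg _)
    exact mul_le_of_le_one_right (by positivity)
      (pow_le_one₀ (norm_nonneg _) (mem_unitDisk.1 hz).le)
  have h0 : ‖polyFn c 0‖ ≤ ‖c‖ * ∑ _k : Fin N, (1 : ℝ) := by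
    rw [polyFn, Finset.mul_sum]
    refine norm_sum_le_of_le _ fun k _ => ?_
    rw [norm_mul, norm_pow]
    refine mul_le_mul (norm_le_pi_norm c k) ?_ (by positivity) (norm_nonneg _)
    exact pow_le_one₀ (norm_nonneg _) (by simp)
  obtain ⟨h1, h2⟩ := memBloch_of_deriv_le hα hd hder
  refine ⟨h1, h2.trans ?_⟩
  rw [Finset.sum_add_distrib, mul_add]
  linarith

lemma polyFn_lin {N : ℕ} (a b : ℂ) (c d : Fin N → ℂ) :
    polyFn (a • c + b • d) = fun z => a * polyFn c z + b * polyFn d z := by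
  funext z
  simp only [polyFn, Finset.mul_sum, ← Finset.sum_add_distrib, Pi.add_apply, Pi.smul_apply,
    smul_eq_mul]
  exact Finset.sum_congr rfl fun k _ => by ring

/-- If `uC_φ` is bounded, then precomposing it with a bounded finite rank operator whose
range consists of polynomials gives a compact operator. -/
lemma isCompactOpToZygmund_wcomp_polyFn {α β : ℝ} (hα : 0 ≤ α) {u φ : ℂ → ℂ}
    (hb : BoundedBlochToZygmund α β u φ) {N : ℕ} {L : (ℂ → ℂ) → Fin N → ℂ}
    (hlin : ∀ f g, MemBloch α f → MemBloch α g → ∀ a b : ℂ,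
      L (fun z => a * f z + b * g z) = a • L f + b • L g) {A : ℝ}
    (hA : ∀ f, MemBloch α f → blochNorm α f ≤ 1 → ‖L f‖ ≤ A) :
    IsCompactOpToZygmund α β (MemBloch α) (fun f => wcomp u φ (polyFn (L f))) := by
  obtain ⟨hmem, C, hC, hbound⟩ := hb
  obtain ⟨S, hS⟩ : ∃ S, S = ∑ k : Fin N, ((k : ℝ) + 1) := ⟨_, rfl⟩
  have hS0 : 0 ≤ S := hS ▸ Finset.sum_nonneg fun k _ => by positivity
  have hpoly : ∀ c : Fin N → ℂ, zygNorm β (wcomp u φ (polyFn c)) ≤ C * (‖c‖ * S) := fun c => by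
    obtain ⟨h1, h2⟩ := memBloch_polyFn hα c
    exact (hbound _ h1).trans (mul_le_mul_of_nonneg_left (hS ▸ h2) hC.le)
  have hmemp : ∀ c : Fin N → ℂ, MemZygmund β (wcomp u φ (polyFn c)) := fun c =>
    hmem _ (memBloch_polyFn hα c).1
  refine ⟨fun f g hf hg a b => ?_, fun f _ => hmemp _, ⟨C * (A * S), fun f hf => ?_⟩,
    fun ε hε => ?_⟩
  · simp only
    rw [hlin f g hf hg, polyFn_lin, wcomp_lin]
  · have hA0 : 0 ≤ A := by
      have h0 := memBloch_of_deriv_le (f := fun _ => 0) (c := 0) hα (by fun_prop) (by simp)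
      exact (norm_nonneg _).trans (hA _ h0.1 (h0.2.trans (by simp)))
    have key : ∀ m : ℝ, blochNorm α f < m → zygNorm β (wcomp u φ (polyFn (L f))) ≤
        C * (A * S) * m := by
      intro m hm
      have hm0 : 0 < m := (blochNorm_nonneg α f).trans_lt hm
      obtain ⟨h1, h2⟩ := hf.lin hf (m⁻¹ : ℝ) 0
      have h3 : blochNorm α (fun z => ((m⁻¹ : ℝ) : ℂ) * f z + 0 * f z) ≤ 1 := by
        refine h2.trans ?_
        rw [Complex.norm_real, Real.norm_of_nonneg (by positivity), norm_zero, zero_mul, add_zero,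
          inv_mul_le_iff₀ hm0]
        linarith
      have h4 := hA _ h1 h3
      rw [hlin f f hf hf, zero_smul, add_zero, norm_smul, Complex.norm_real,
        Real.norm_of_nonneg (by positivity), inv_mul_le_iff₀ hm0] at h4
      calc _ ≤ C * (‖L f‖ * S) := hpoly _
        _ ≤ C * ((m * A) * S) := by gcongr
        _ = _ := by ring
    refine le_of_forall_pos_le_add fun η hη => ?_
    have hq : 0 ≤ C * (A * S) := by positivity
    refine (key (blochNorm α f + η / (C * (A * S) + 1)) (by
      have : 0 < η / (C * (A * S) + 1) := by positivity
      linarith)).trans ?_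
    rw [mul_add]
    gcongr
    rw [mul_div_assoc', div_le_iff₀ (by positivity)]
    nlinarith
  · have hδ : 0 < ε / (C * S + 1) := by positivity
    obtain ⟨t, -, htf, hcov⟩ := (isCompact_closedBall (0 : Fin N → ℂ) A).finite_cover_balls hδ
    classical
    refine ⟨htf.toFinset.image fun c => wcomp u φ (polyFn c), ?_, fun f hf hf1 => ?_⟩
    · intro g hg
      obtain ⟨c, -, rfl⟩ := Finset.mem_image.1 hg
      exact hmemp c
    · have hmemA : L f ∈ Metric.closedBall (0 : Fin N → ℂ) A := by simpa using hA f hf hf1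
      obtain ⟨c, hc, hfc⟩ := mem_iUnion₂.1 (hcov hmemA)
      refine ⟨_, Finset.mem_image_of_mem _ (htf.mem_toFinset.2 hc), ?_⟩
      have e : (fun z => wcomp u φ (polyFn (L f)) z - wcomp u φ (polyFn c) z) =
          wcomp u φ (polyFn (L f - c)) := by
        rw [show L f - c = (1 : ℂ) • L f + (-1 : ℂ) • c by
          rw [one_smul, neg_one_smul, sub_eq_add_neg], polyFn_lin, wcomp_lin]
        funext z; ring
      have hd : ‖L f - c‖ ≤ ε / (C * S + 1) := by
        rw [← dist_eq_norm]; exact (Metric.mem_ball.1 hfc).le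
      rw [e]
      calc _ ≤ C * (‖L f - c‖ * S) := hpoly _
        _ ≤ C * (ε / (C * S + 1) * S) := by gcongr
        _ = C * S * ε / (C * S + 1) := by ring
        _ ≤ ε := by
          rw [div_le_iff₀ (by positivity)]
          nlinarith

lemma dilateCoeff_lin {f g : ℂ → ℂ} (hf : DifferentiableOn ℂ f unitDisk)
    (hg : DifferentiableOn ℂ g unitDisk) (r : ℝ) (k : ℕ) (a b : ℂ) :
    dilateCoeff r k (fun z => a * f z + b * g z) =
      a * dilateCoeff r k f + b * dilateCoeff r k g := by
  have h : ∀ {f : ℂ → ℂ}, DifferentiableOn ℂ f unitDisk → ContDiffAt ℂ k f 0 := fun hf =>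
    (hf.contDiffOn isOpen_unitDisk).contDiffAt (unitDisk_mem_nhds zero_mem_unitDisk)
  simp only [dilateCoeff]
  rw [iteratedDeriv_fun_add (contDiffAt_const.mul (h hf)) (contDiffAt_const.mul (h hg)),
    iteratedDeriv_const_mul_field, iteratedDeriv_const_mul_field]
  ring

lemma isCompactOpToZygmund_dilate_taylor {α β : ℝ} (hα : 1 < α) {u φ : ℂ → ℂ}
    (hb : BoundedBlochToZygmund α β u φ) {r : ℝ} (hr : 0 ≤ r) (hr1 : r < 1) (N : ℕ) :
    IsCompactOpToZygmund α β (MemBloch α)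
      (fun f => wcomp u φ (polyFn fun k : Fin N => dilateCoeff r k f)) := by
  obtain ⟨C, hC, hgrow⟩ := exists_bloch_growth hα
  refine isCompactOpToZygmund_wcomp_polyFn (by linarith) hb
    (L := fun f (k : Fin N) => dilateCoeff r k f)
    (A := C * (1 - (1 / 2 : ℝ) ^ 2) ^ (-(α - 1)) * 2 ^ N) ?_ ?_
  · intro f g hf hg a b
    funext k
    simp only [dilateCoeff_lin hf.1 hg.1, Pi.add_apply, Pi.smul_apply, smul_eq_mul]
  · intro f hf hf1
    refine (pi_norm_le_iff_of_nonneg (by positivity)).2 fun k => ?_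
    have h1 := norm_taylor_coeff_le (t := 1 / 2) (M := C * (1 - (1 / 2 : ℝ) ^ 2) ^ (-(α - 1)))
      (by norm_num) (by norm_num) hf.1 (fun z hz => by
        have hz' : ‖z‖ = 1 / 2 := by simpa using hz
        have := (hgrow f hf hf1 z (mem_unitDisk.2 (by rw [hz']; norm_num))).1
        rwa [hz'] at this) k
    rw [dilateCoeff, norm_mul, norm_pow, Complex.norm_real, Real.norm_of_nonneg hr]
    refine (mul_le_of_le_one_right (norm_nonneg _) (pow_le_one₀ hr hr1.le)).trans (h1.trans ?_)
    rw [div_eq_mul_inv _ ((1 / 2 : ℝ) ^ (k : ℕ))]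
    refine mul_le_mul_of_nonneg_left ?_ (by positivity)
    rw [one_div, inv_pow, inv_inv]
    exact pow_le_pow_right₀ (by norm_num) k.2.le

/-- `uC_φ` is approximated by compact operators up to the boundary size of the coefficient
functions of `(u · f ∘ φ)''`. -/
lemma exists_compact_zygNorm_sub_le {α : ℝ} (hα : 1 < α) : ∃ C : ℝ, 0 < C ∧
    ∀ (β : ℝ) (u φ : ℂ → ℂ), DifferentiableOn ℂ u unitDisk → DifferentiableOn ℂ φ unitDisk →
      Set.MapsTo φ unitDisk unitDisk → BoundedBlochToZygmund α β u φ →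
      ∀ E s : ℝ, 0 ≤ E → s < 1 →
      (∀ z ∈ unitDisk, s < ‖φ z‖ →
        (1 - ‖z‖ ^ 2) ^ β * ‖deriv (deriv u) z‖ ≤ E * (1 - ‖φ z‖ ^ 2) ^ (α - 1) ∧
        (1 - ‖z‖ ^ 2) ^ β * ‖2 * deriv u z * deriv φ z + u z * deriv (deriv φ) z‖ ≤
          E * (1 - ‖φ z‖ ^ 2) ^ α ∧
        (1 - ‖z‖ ^ 2) ^ β * ‖u z * deriv φ z ^ 2‖ ≤ E * (1 - ‖φ z‖ ^ 2) ^ (α + 1)) →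
      ∀ ε : ℝ, 0 < ε → ∃ K, IsCompactOpToZygmund α β (MemBloch α) K ∧
        ∀ f, MemBloch α f → blochNorm α f ≤ 1 →
          zygNorm β (fun z => wcomp u φ f z - K f z) ≤ C * E + ε := by
  obtain ⟨C, hC, hdil⟩ := exists_zygNorm_sub_dilate_le hα
  refine ⟨C, hC, fun β u φ hu hφ hm hb E s hE hs1 hcoef ε hε => ?_⟩
  obtain ⟨r₀, hr₀, hr₀1, hA⟩ := hdil β u φ hu hφ hm hb E s hE hs1 hcoef (ε / 2) (by positivity)
  obtain ⟨D, hD, hbound⟩ := hb.2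
  obtain ⟨r, hr, hr1, N, hT⟩ := exists_dilate_taylor_approx hα hr₀ hr₀1
    (ε := ε / (2 * D)) (by positivity)
  have hr0 : 0 ≤ r := hr₀.trans hr.le
  refine ⟨_, isCompactOpToZygmund_dilate_taylor hα hb hr0 hr1 N, fun f hf hf1 => ?_⟩
  have hα0 : 0 ≤ α := by linarith
  have hfr := memBloch_dilate hα0 hr0 hr1 hf.1
  have hp := (memBloch_polyFn hα0 fun k : Fin N => dilateCoeff r k f).1
  have m1 := hf.sub hfr
  have m2 := hfr.sub hp
  have e1 := hA r hr hr1 f hf hf1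
  have e2 := hT f hf hf1
  simp only [Finset.sum_range] at e2
  have e3 := (hbound _ m2).trans (mul_le_mul_of_nonneg_left e2 hD.le)
  have e4 := ((hb.1 _ m1).add (hb.1 _ m2)).2
  have e5 : (fun z => wcomp u φ f z - wcomp u φ (polyFn fun k : Fin N => dilateCoeff r k f) z) =
      fun z => wcomp u φ (fun z => f z - f (r * z)) z +
        wcomp u φ (fun z => f (r * z) - polyFn (fun k : Fin N => dilateCoeff r k f) z) z := by
    funext z; simp only [wcomp]; ring
  rw [e5]
  have e6 : D * (ε / (2 * D)) = ε / 2 := by field_simp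
  linarith

/-! ### Comparison of the essential norm with the sequential quantities -/

lemma exists_eventually_le_of_compact {α : ℝ} (hα : 1 < α) : ∃ C : ℝ, 0 < C ∧
    ∀ (β : ℝ) (u φ : ℂ → ℂ), DifferentiableOn ℂ u unitDisk → DifferentiableOn ℂ φ unitDisk →
      Set.MapsTo φ unitDisk unitDisk → BoundedBlochToZygmund α β u φ →
      ∀ K, IsCompactOpToZygmund α β (MemBloch α) K → ∀ L : ℝ,
      (∀ f, MemBloch α f → blochNorm α f ≤ 1 →
        zygNorm β (fun z => wcomp u φ f z - K f z) ≤ L) →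
      ∀ δ : ℝ, 0 < δ → ∀ᶠ n : ℕ in atTop,
        ((n : ℝ) + 1) ^ α * wnorm β (fun z =>
          (2 * deriv u z * deriv φ z + u z * deriv (deriv φ) z) * φ z ^ n) ≤ C * (L + δ) ∧
        ((n : ℝ) + 1) ^ (α + 1) * wnorm β (fun z => u z * deriv φ z ^ 2 * φ z ^ n) ≤
          C * (L + δ) ∧
        ((n : ℝ) + 1) ^ (α - 1) * wnorm β (fun z => deriv (deriv u) z * φ z ^ n) ≤
          C * (L + δ) := by
  obtain ⟨C₀, hC₀, hcomp⟩ := exists_coeff_le_of_compact (by linarith : 0 < α)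
  obtain ⟨C₁, hC₁, h₁⟩ := eventually_rpow_mul_wnorm_le (by linarith : 0 < α)
  obtain ⟨C₂, hC₂, h₂⟩ := eventually_rpow_mul_wnorm_le (by linarith : 0 < α + 1)
  obtain ⟨C₃, hC₃, h₃⟩ := eventually_rpow_mul_wnorm_le (by linarith : 0 < α - 1)
  refine ⟨(C₁ + C₂ + C₃) * C₀ + 1, by positivity,
    fun β u φ hu hφ hm hb K hK L hL δ hδ => ?_⟩
  have hα0 : 0 ≤ α := by linarith
  obtain ⟨c, hc⟩ := coeff_bounds hα0 hu hφ hm hb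
  obtain ⟨s, hs0, hs1, hs⟩ := hcomp β u φ hu hφ hm hb K hK L hL δ hδ
  have hL0 : 0 ≤ L := by
    have h0 := memBloch_of_deriv_le (f := fun _ => 0) (c := 0) hα0 (by fun_prop) (by simp)
    exact (zygNorm_nonneg _ _).trans (hL _ h0.1 (h0.2.trans (by simp)))
  have hE : 0 ≤ C₀ * (L + δ) := by positivity
  have hp₁ : 0 ≤ C₁ * (C₀ * (L + δ)) := by positivity
  have hp₂ : 0 ≤ C₂ * (C₀ * (L + δ)) := by positivity
  have hp₃ : 0 ≤ C₃ * (C₀ * (L + δ)) := by positivity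
  filter_upwards [h₁ β φ _ hm c s _ δ (fun z hz => (hc z hz).2.1) hs0 hs1 hE hδ
      (fun z hz hzs => (hs z hz hzs).2.1),
    h₂ β φ _ hm c s _ δ (fun z hz => (hc z hz).2.2) hs0 hs1 hE hδ
      (fun z hz hzs => (hs z hz hzs).2.2),
    h₃ β φ _ hm c s _ δ (fun z hz => (hc z hz).1) hs0 hs1 hE hδ
      (fun z hz hzs => (hs z hz hzs).1)] with n e₁ e₂ e₃
  refine ⟨e₁.trans ?_, e₂.trans ?_, e₃.trans ?_⟩ <;> linarith

lemma bddAbove_zygNorm_sub {α β : ℝ} {u φ : ℂ → ℂ} (hb : BoundedBlochToZygmund α β u φ)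
    {K : (ℂ → ℂ) → ℂ → ℂ} (hK : IsCompactOpToZygmund α β (MemBloch α) K) :
    BddAbove {s | ∃ f, MemBloch α f ∧ blochNorm α f ≤ 1 ∧
      s = zygNorm β (fun z => wcomp u φ f z - K f z)} := by
  obtain ⟨hmem, C, hC, hbd⟩ := hb
  obtain ⟨-, hKmem, ⟨D, hD⟩, -⟩ := hK
  refine ⟨C + |D|, ?_⟩
  rintro _ ⟨f, hf, hf1, rfl⟩
  refine (((hmem f hf).sub (hKmem f hf)).2).trans (add_le_add ?_ ?_)
  · exact (hbd f hf).trans (mul_le_of_le_one_right hC.le hf1)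
  · calc _ ≤ D * blochNorm α f := hD f hf
      _ ≤ |D| * blochNorm α f :=
        mul_le_mul_of_nonneg_right (le_abs_self D) (blochNorm_nonneg α f)
      _ ≤ |D| := mul_le_of_le_one_right (abs_nonneg D) hf1

lemma essNormZ_le {α β : ℝ} {u φ : ℂ → ℂ} {K : (ℂ → ℂ) → ℂ → ℂ}
    (hK : IsCompactOpToZygmund α β (MemBloch α) K) {L : ℝ} (hL0 : 0 ≤ L)
    (hL : ∀ f, MemBloch α f → blochNorm α f ≤ 1 →
      zygNorm β (fun z => wcomp u φ f z - K f z) ≤ L) :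
    essNormZ α β (MemBloch α) u φ ≤ L := by
  refine le_trans (csInf_le ⟨0, ?_⟩ ⟨K, hK, rfl⟩) (Real.sSup_le ?_ hL0)
  · rintro _ ⟨K', -, rfl⟩
    refine Real.sSup_nonneg ?_
    rintro _ ⟨f, -, -, rfl⟩
    exact zygNorm_nonneg _ _
  · rintro _ ⟨f, hf, hf1, rfl⟩
    exact hL f hf hf1

lemma rpow_mul_wnorm_nonneg (β γ : ℝ) (g : ℕ → ℂ → ℂ) (n : ℕ) :
    0 ≤ ((n : ℝ) + 1) ^ γ * wnorm β (g n) :=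
  mul_nonneg (by positivity) (wnorm_nonneg _ _)

lemma limsup_rpow_mul_wnorm_le {β γ B : ℝ} {g : ℕ → ℂ → ℂ}
    (h : ∀ᶠ n : ℕ in atTop, ((n : ℝ) + 1) ^ γ * wnorm β (g n) ≤ B) :
    limsup (fun n : ℕ => ((n : ℝ) + 1) ^ γ * wnorm β (g n)) atTop ≤ B :=
  limsup_le_of_le (isCoboundedUnder_le_of_le atTop (rpow_mul_wnorm_nonneg β γ g)) h

/-- **Theorem 4.4** (sequential form). For `α > 1` and `uC_φ : B^α → Z_β` bounded,
`‖uC_φ‖_e` is comparable with the maximum of the three sequential limsup quantities, with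
constants depending only on `α, β`. -/
theorem essNorm_Bloch_to_Zygmund_of_one_lt
    (α β : ℝ) (hα : 1 < α) (hβ : 0 < β) :
    ∃ c C : ℝ, 0 < c ∧ 0 < C ∧
      ∀ u φ : ℂ → ℂ, DifferentiableOn ℂ u unitDisk → DifferentiableOn ℂ φ unitDisk →
        Set.MapsTo φ unitDisk unitDisk → BoundedBlochToZygmund α β u φ →
        c * max
              (max
                (Filter.limsup
                  (fun n : ℕ => ((n : ℝ) + 1) ^ α * wnorm β (fun z => (2 * deriv u z * deriv φ z + u z * deriv (deriv φ) z) * φ z ^ n)) Filter.atTop)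
                (Filter.limsup
                  (fun n : ℕ => ((n : ℝ) + 1) ^ (α + 1) * wnorm β (fun z => u z * deriv φ z ^ 2 * φ z ^ n)) Filter.atTop))
              (Filter.limsup
                (fun n : ℕ => ((n : ℝ) + 1) ^ (α - 1) * wnorm β (fun z => deriv (deriv u) z * φ z ^ n)) Filter.atTop)
            ≤ essNormZ α β (MemBloch α) u φ ∧
          essNormZ α β (MemBloch α) u φ
            ≤ C * max
                (max
                  (Filter.limsup
                    (fun n : ℕ => ((n : ℝ) + 1) ^ α * wnorm β (fun z => (2 * deriv u z * deriv φ z + u z * deriv (deriv φ) z) * φ z ^ n)) Filter.atTop)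
                  (Filter.limsup
                    (fun n : ℕ => ((n : ℝ) + 1) ^ (α + 1) * wnorm β (fun z => u z * deriv φ z ^ 2 * φ z ^ n)) Filter.atTop))
                (Filter.limsup
                  (fun n : ℕ => ((n : ℝ) + 1) ^ (α - 1) * wnorm β (fun z => deriv (deriv u) z * φ z ^ n)) Filter.atTop) := by
  obtain ⟨C₁, hC₁, hlow⟩ := exists_eventually_le_of_compact hα
  obtain ⟨C₂, hC₂, hup⟩ := exists_compact_zygNorm_sub_le hα
  refine ⟨C₁⁻¹, C₂ * (2 * 2 ^ (α + 1)), by positivity, by positivity,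
    fun u φ hu hφ hm hb => ?_⟩
  have hα0 : 0 ≤ α := by linarith
  have hK₀ := isCompactOpToZygmund_dilate_taylor hα hb le_rfl one_pos 0
  obtain ⟨c, hc⟩ := coeff_bounds hα0 hu hφ hm hb
  constructor
  · refine le_csInf ⟨_, _, hK₀, rfl⟩ ?_
    rintro _ ⟨K, hK, rfl⟩
    have hL : ∀ f, MemBloch α f → blochNorm α f ≤ 1 →
        zygNorm β (fun z => wcomp u φ f z - K f z) ≤ _ := fun f hf hf1 =>
      le_csSup (bddAbove_zygNorm_sub hb hK) ⟨f, hf, hf1, rfl⟩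
    rw [inv_mul_le_iff₀ hC₁]
    refine le_of_forall_pos_le_add fun δ hδ => ?_
    have h := hlow β u φ hu hφ hm hb K hK _ hL (δ / C₁) (by positivity)
    rw [mul_add, mul_div_cancel₀ _ hC₁.ne'] at h
    exact max_le (max_le (limsup_rpow_mul_wnorm_le (h.mono fun n hn => hn.1))
      (limsup_rpow_mul_wnorm_le (h.mono fun n hn => hn.2.1)))
      (limsup_rpow_mul_wnorm_le (h.mono fun n hn => hn.2.2))
  · have hbdd := hlow β u φ hu hφ hm hb _ hK₀ _ (fun f hf hf1 =>
      le_csSup (bddAbove_zygNorm_sub hb hK₀) ⟨f, hf, hf1, rfl⟩) 1 one_pos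
    set M₁ := limsup (fun n : ℕ => ((n : ℝ) + 1) ^ α * wnorm β (fun z =>
      (2 * deriv u z * deriv φ z + u z * deriv (deriv φ) z) * φ z ^ n)) atTop with hM₁
    set M₂ := limsup (fun n : ℕ => ((n : ℝ) + 1) ^ (α + 1) *
      wnorm β (fun z => u z * deriv φ z ^ 2 * φ z ^ n)) atTop with hM₂
    set M₃ := limsup (fun n : ℕ => ((n : ℝ) + 1) ^ (α - 1) *
      wnorm β (fun z => deriv (deriv u) z * φ z ^ n)) atTop with hM₃
    set M := max (max M₁ M₂) M₃ with hM
    have l₁ : M₁ ≤ M := (le_max_left _ _).trans (le_max_left _ _)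
    have l₂ : M₂ ≤ M := (le_max_right _ _).trans (le_max_left _ _)
    have l₃ : M₃ ≤ M := le_max_right _ _
    refine le_of_forall_pos_le_add fun ε hε => ?_
    obtain ⟨A, hA⟩ : ∃ A, A = C₂ * (2 * 2 ^ (α + 1)) := ⟨_, rfl⟩
    have hA0 : 0 < A := by rw [hA]; positivity
    obtain ⟨E, hE⟩ : ∃ E, E = M + ε / 2 / A := ⟨_, rfl⟩
    have hME : M < E := by
      have : 0 < ε / 2 / A := by positivity
      linarith
    have h₁ := eventually_lt_of_limsup_lt (hM₁ ▸ l₁.trans_lt hME)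
      ⟨_, eventually_map.2 (hbdd.mono fun n hn => hn.1)⟩
    have h₂ := eventually_lt_of_limsup_lt (hM₂ ▸ l₂.trans_lt hME)
      ⟨_, eventually_map.2 (hbdd.mono fun n hn => hn.2.1)⟩
    have h₃ := eventually_lt_of_limsup_lt (hM₃ ▸ l₃.trans_lt hME)
      ⟨_, eventually_map.2 (hbdd.mono fun n hn => hn.2.2)⟩
    have hE0 : 0 ≤ E := by
      obtain ⟨n, hn⟩ := h₁.exists
      exact (mul_nonneg (by positivity) (wnorm_nonneg _ _)).trans hn.le
    obtain ⟨s₁, -, hs₁1, hs₁⟩ := weight_le_of_eventually (by linarith) hm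
      (fun z hz => (hc z hz).2.1) (h₁.mono fun n hn => hn.le)
    obtain ⟨s₂, -, hs₂1, hs₂⟩ := weight_le_of_eventually (by linarith) hm
      (fun z hz => (hc z hz).2.2) (h₂.mono fun n hn => hn.le)
    obtain ⟨s₃, -, hs₃1, hs₃⟩ := weight_le_of_eventually (by linarith) hm
      (fun z hz => (hc z hz).1) (h₃.mono fun n hn => hn.le)
    have hexp : ∀ γ : ℝ, γ ≤ α + 1 → ∀ z ∈ unitDisk, 2 * 2 ^ γ * E * (1 - ‖φ z‖ ^ 2) ^ γ ≤
        2 * 2 ^ (α + 1) * E * (1 - ‖φ z‖ ^ 2) ^ γ := by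
      intro γ hγ z hz
      have hy := one_sub_norm_sq_pos (hm hz)
      have : (2 : ℝ) ^ γ ≤ 2 ^ (α + 1) := Real.rpow_le_rpow_of_exponent_le (by norm_num) hγ
      gcongr
    obtain ⟨K, hK, hKle⟩ := hup β u φ hu hφ hm hb (2 * 2 ^ (α + 1) * E) (max (max s₁ s₂) s₃)
      (by positivity) (max_lt (max_lt hs₁1 hs₂1) hs₃1) (fun z hz hzs => by
        obtain ⟨h12, hz₃⟩ := max_lt_iff.1 hzs
        obtain ⟨hz₁, hz₂⟩ := max_lt_iff.1 h12
        exact ⟨(hs₃ z hz hz₃).trans (hexp _ (by linarith) z hz),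
          (hs₁ z hz hz₁).trans (hexp _ (by linarith) z hz),
          (hs₂ z hz hz₂).trans (hexp _ le_rfl z hz)⟩) (ε / 2) (by positivity)
    refine (essNormZ_le hK (by positivity) hKle).trans (le_of_eq ?_)
    rw [← hA, ← mul_assoc, ← hA, hE, mul_add, mul_div_cancel₀ _ hA0.ne']
    ring

end
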